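/- arXiv:1910.03140 — 4 statements merged into one kernel-verified Lean document; each statement's English description precedes it below -/
import Mathlib

section
/- Let N ≥ 1, let S be a nonempty finite set (of lattice sites), and let B be a finite family of bonds, where each bond b ∈ B consists of two distinct sites x_b ≠ y_b in S together with an N×N real orthogonal matrix g_b. Let ν be the product over sites x ∈ S of the standard Gaussian probability measure (2π)^{−N/2} e^{−|φ(x)|²/2} dφ(x) on ℝ^N, and let κ ∈ ℝ. Then ∫ exp( κ² ∑_{b ∈ B} ⟨φ(x_b), g_b φ(y_b)⟩ ) dν(φ) ≥ 1, where ⟨·,·⟩ is the Euclidean inner product on ℝ^N. -/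
open Real MeasureTheory Matrix ProbabilityTheory

theorem jl_aux {S : Type} [Fintype S] (N : ℕ) (s t : S) (hst : s ≠ t) (i j : Fin N) :
    Integrable (fun φ : S → Fin N → ℝ => φ s i * φ t j)
      (Measure.pi fun _ : S => Measure.pi fun _ : Fin N => gaussianReal 0 1) ∧
    ∫ φ : S → Fin N → ℝ, φ s i * φ t j
      ∂(Measure.pi fun _ : S => Measure.pi fun _ : Fin N => gaussianReal 0 1) = 0 := by
  set μ := (Measure.pi fun _ : S => Measure.pi fun _ : Fin N => gaussianReal 0 1) with hμ
  have mp : ∀ (s : S) (i : Fin N),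
      MeasurePreserving (fun φ : S → Fin N → ℝ => φ s i) μ (gaussianReal 0 1) := fun s i =>
    (measurePreserving_eval (fun _ : Fin N => gaussianReal 0 1) i).comp
      (measurePreserving_eval
        (fun _ : S => Measure.pi fun _ : Fin N => gaussianReal 0 1) s)
  have hid : Integrable (fun z : ℝ => z) (gaussianReal 0 1) :=
    (memLp_id_gaussianReal 1).integrable (by simp)
  have hint : ∀ (s : S) (i : Fin N), Integrable (fun φ : S → Fin N → ℝ => φ s i) μ := fun s i =>
    (mp s i).integrable_comp_of_integrable hid
  have hzero : ∫ φ : S → Fin N → ℝ, φ s i ∂μ = 0 := by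
    have h1 : ∫ z, z ∂(Measure.map (fun φ : S → Fin N → ℝ => φ s i) μ) = ∫ φ, φ s i ∂μ :=
      integral_map (mp s i).measurable.aemeasurable (by fun_prop)
    rw [← h1, (mp s i).map_eq]
    simp
  have hI : iIndepFun (fun (s : S) (φ : S → Fin N → ℝ) => φ s) μ :=
    iIndepFun_pi (X := fun (_ : S) (z : Fin N → ℝ) => z) (fun _ => aemeasurable_id)
  have hind : IndepFun (fun φ : S → Fin N → ℝ => φ s i) (fun φ => φ t j) μ :=
    (hI.indepFun hst).comp (measurable_pi_apply i) (measurable_pi_apply j)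
  refine ⟨hind.integrable_mul (hint s i) (hint t j), ?_⟩
  have h2 := hind.integral_mul_eq_mul_integral (hint s i).aestronglyMeasurable
    (hint t j).aestronglyMeasurable
  have h3 : ∫ φ : S → Fin N → ℝ, φ s i * φ t j ∂μ = (∫ φ, φ s i ∂μ) * ∫ φ, φ t j ∂μ := h2
  rw [h3, hzero, zero_mul]

/-- Jensen lower bound for the scaled Bose-gauge partition function:
given a finite nonempty set `S` of sites, a finite family of bonds `b` each consisting of two
distinct sites `x b ≠ y b` and an orthogonal matrix `G b`, and the product over sites of the
standard Gaussian measure on `ℝ^N`, one has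
`∫ exp(κ² ∑_b ⟨φ(x_b), G_b φ(y_b)⟩) dν(φ) ≥ 1`. -/
theorem bose_gauge_partition_jensen_lower_bound (N : ℕ) (hN : 1 ≤ N)
    (S : Type) [Fintype S] [Nonempty S]
    (ι : Type) [Fintype ι] (x y : ι → S) (G : ι → Matrix (Fin N) (Fin N) ℝ)
    (hxy : ∀ b : ι, x b ≠ y b)
    (hG : ∀ b : ι, G b ∈ Matrix.orthogonalGroup (Fin N) ℝ) (κ : ℝ) :
    1 ≤ ∫⁻ φ : S → Fin N → ℝ,
          ENNReal.ofReal
            (Real.exp (κ ^ 2 * ∑ b : ι, ∑ i, φ (x b) i * (G b).mulVec (φ (y b)) i))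
        ∂(Measure.pi fun _ : S => Measure.pi fun _ : Fin N => gaussianReal 0 1) := by
  set μ := (Measure.pi fun _ : S => Measure.pi fun _ : Fin N => gaussianReal 0 1) with hμ
  set f : (S → Fin N → ℝ) → ℝ :=
    fun φ => κ ^ 2 * ∑ b : ι, ∑ i, φ (x b) i * (G b).mulVec (φ (y b)) i with hf
  have hfe : f = fun φ => κ ^ 2 * ∑ b : ι, ∑ i, ∑ j, G b i j * (φ (x b) i * φ (y b) j) := by
    funext φ
    simp only [hf, Matrix.mulVec, dotProduct, Finset.mul_sum]
    refine Finset.sum_congr rfl fun b _ => Finset.sum_congr rfl fun i _ =>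
      Finset.sum_congr rfl fun j _ => by ring
  have hA := fun b i j => jl_aux N (x b) (y b) (hxy b) i j
  have h0 : ∀ b i j, Integrable (fun φ : S → Fin N → ℝ => G b i j * (φ (x b) i * φ (y b) j)) μ :=
    fun b i j => (hA b i j).1.const_mul _
  have h1 : ∀ b i, Integrable
      (fun φ : S → Fin N → ℝ => ∑ j, G b i j * (φ (x b) i * φ (y b) j)) μ :=
    fun b i => integrable_finsetSum _ fun j _ => h0 b i j
  have h2 : ∀ b, Integrable
      (fun φ : S → Fin N → ℝ => ∑ i, ∑ j, G b i j * (φ (x b) i * φ (y b) j)) μ :=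
    fun b => integrable_finsetSum _ fun i _ => h1 b i
  have hint : Integrable f μ := by
    rw [hfe]
    exact (integrable_finsetSum _ fun b _ => h2 b).const_mul _
  have hz : ∫ φ, f φ ∂μ = 0 := by
    rw [hfe, integral_const_mul, integral_finsetSum _ fun b _ => h2 b]
    rw [Finset.sum_eq_zero, mul_zero]
    intro b _
    rw [integral_finsetSum _ fun i _ => h1 b i]
    refine Finset.sum_eq_zero fun i _ => ?_
    rw [integral_finsetSum _ fun j _ => h0 b i j]
    refine Finset.sum_eq_zero fun j _ => ?_
    rw [integral_const_mul, (hA b i j).2, mul_zero]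
  have hint1 : Integrable (fun φ => f φ + 1) μ := hint.add (integrable_const 1)
  have hone : ∫ φ, (f φ + 1) ∂μ = 1 := by
    rw [integral_add hint (integrable_const 1), hz]
    simp
  have hle : (1 : ENNReal) ≤ ∫⁻ φ, ENNReal.ofReal (f φ + 1) ∂μ := by
    have h := integral_eq_lintegral_pos_part_sub_lintegral_neg_part hint1
    rw [hone] at h
    by_contra hlt
    push Not at hlt
    have h5 : (∫⁻ φ, ENNReal.ofReal (f φ + 1) ∂μ).toReal < 1 := by
      have := (ENNReal.toReal_lt_toReal hlt.ne_top ENNReal.one_ne_top).2 hlt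
      simpa using this
    have h6 := ENNReal.toReal_nonneg (a := ∫⁻ φ, ENNReal.ofReal (-(f φ + 1)) ∂μ)
    linarith
  exact hle.trans (lintegral_mono fun φ => ENNReal.ofReal_le_ofReal (Real.add_one_le_exp _))
end

section
/- Fix integers d ≥ 1, L ≥ 2, N ≥ 1. Let Λ = {1,…,L}^d be the sites of a hypercubic lattice, and let the bonds be the nearest-neighbor pairs (x, x + e_μ) with both endpoints in Λ, for μ = 1,…,d (free boundary conditions). For each bond b let g_b be an N×N real orthogonal matrix, let κ² be a real number with 0 ≤ κ² ≤ 1/(2d), and define the scaled Bose-gauge partition function Z = ∫ exp( κ² ∑_{bonds b=(x,y)} ⟨φ(x), g_b φ(y)⟩ ) ∏_{x ∈ Λ} (2π)^{−N/2} e^{−|φ(x)|²/2} dφ(x), an integral over (ℝ^N)^Λ, where ⟨·,·⟩ is the Euclidean inner product. Then 1 ≤ Z ≤ 2^{N(L−1)L^{d−1}/2}. In particular, Z ≤ e^{c_u Λ_s} with Λ_s = L^d and c_u = (N ln 2)/2, a constant independent of L, of κ², and of the gauge configuration (g_b). -/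
open Real MeasureTheory Matrix ProbabilityTheory
open scoped ENNReal

/-- The hopping term `∑_{bonds b=(x, x+e_μ)} ⟨φ(x), g_b φ(x+e_μ)⟩` of the scaled Bose-gauge
action on the hypercubic lattice `{1,…,L}^d` with free boundary conditions: the (directed)
bonds are the nearest-neighbor pairs `(x, x + e_μ)` with both endpoints in the lattice. -/
noncomputable def hoppingSum (d L N : ℕ)
    (g : (Fin d → Fin L) → Fin d → Matrix (Fin N) (Fin N) ℝ)
    (φ : (Fin d → Fin L) → Fin N → ℝ) : ℝ :=
  ∑ μ : Fin d, ∑ x : Fin d → Fin L,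
    if h : (x μ : ℕ) + 1 < L then
      ∑ i, φ x i * (g x μ).mulVec (φ (Function.update x μ ⟨(x μ : ℕ) + 1, h⟩)) i
    else 0

/-- The scaled Bose-gauge partition function
`Z = ∫ exp(κ² ∑_b ⟨φ(x), g_b φ(y)⟩) ∏_{x ∈ Λ} (2π)^{−N/2} e^{−|φ(x)|²/2} dφ(x)`,
as a Lebesgue integral with respect to the product of standard Gaussian measures. -/
noncomputable def bosePartition (d L N : ℕ)
    (g : (Fin d → Fin L) → Fin d → Matrix (Fin N) (Fin N) ℝ) (κ2 : ℝ) : ℝ≥0∞ :=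
  ∫⁻ φ : (Fin d → Fin L) → Fin N → ℝ,
      ENNReal.ofReal (Real.exp (κ2 * hoppingSum d L N g φ))
    ∂(Measure.pi fun _ : Fin d → Fin L => Measure.pi fun _ : Fin N => gaussianReal 0 1)


lemma aux_lintegral_pi_prod {V : Type} [Fintype V] {X : Type} [MeasurableSpace X]
    (ν : Measure X) [IsProbabilityMeasure ν] (f : V → X → ℝ≥0∞) (hf : ∀ v, Measurable (f v)) :
    ∫⁻ φ : V → X, ∏ v, f v (φ v) ∂(Measure.pi fun _ : V => ν) = ∏ v, ∫⁻ u, f v u ∂ν := by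
  have h := iIndepFun_pi (μ := fun _ : V => ν) (X := f) (fun i => (hf i).aemeasurable)
  have h2 := lintegral_prod_eq_prod_lintegral_of_indepFun Finset.univ
    (fun (i : V) (φ : V → X) => f i (φ i)) h (fun i => (hf i).comp (measurable_pi_apply i))
  rw [h2]
  refine Finset.prod_congr rfl fun v _ => ?_
  exact (measurePreserving_eval (fun _ : V => ν) v).lintegral_comp (hf v)

lemma aux_gauss0 (t : ℝ) :
    ∫⁻ x, ENNReal.ofReal (exp (t * x)) ∂(gaussianReal 0 1) = ENNReal.ofReal (exp (t ^ 2 / 2)) := by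
  rw [gaussianReal_of_var_ne_zero _ one_ne_zero, lintegral_withDensity_eq_lintegral_mul _ (by fun_prop) (by fun_prop)]
  have : ∀ x, (gaussianPDF 0 1 * fun x => ENNReal.ofReal (exp (t * x))) x
      = ENNReal.ofReal (exp (t ^ 2 / 2)) * gaussianPDF t 1 x := by
    intro x
    simp only [Pi.mul_apply, gaussianPDF, gaussianPDFReal]
    rw [← ENNReal.ofReal_mul (by positivity), ← ENNReal.ofReal_mul (by positivity),
      mul_assoc, mul_left_comm (exp _), ← exp_add, ← exp_add]
    congr 3
    simp
    ring
  simp_rw [this]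
  rw [lintegral_const_mul _ (by fun_prop), lintegral_gaussianPDF_eq_one _ one_ne_zero, mul_one]

lemma aux_gauss1 (t : ℝ) :
    ∫⁻ x, ENNReal.ofReal (exp (t * x + x ^ 2 / 4)) ∂(gaussianReal 0 1)
      = ENNReal.ofReal (√2 * exp (t ^ 2)) := by
  rw [gaussianReal_of_var_ne_zero _ one_ne_zero, lintegral_withDensity_eq_lintegral_mul _ (by fun_prop) (by fun_prop)]
  have : ∀ x, (gaussianPDF 0 1 * fun x => ENNReal.ofReal (exp (t * x + x ^ 2 / 4))) x
      = ENNReal.ofReal (√2 * exp (t ^ 2)) * gaussianPDF (2 * t) 2 x := by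
    intro x
    simp only [Pi.mul_apply, gaussianPDF, gaussianPDFReal]
    rw [← ENNReal.ofReal_mul (by positivity), ← ENNReal.ofReal_mul (by positivity)]
    congr 1
    have h1 : √(2 * π * ((2 : NNReal) : ℝ)) = √2 * √(2 * π) := by
      rw [← Real.sqrt_mul (by norm_num)]; congr 1; push_cast; ring
    have h2 : √(2 * π * ((1 : NNReal) : ℝ)) = √(2 * π) := by simp
    rw [h1, h2]
    have h3 : exp (-(x - 0) ^ 2 / (2 * ((1 : NNReal) : ℝ))) * exp (t * x + x ^ 2 / 4)
        = exp (t ^ 2) * exp (-(x - 2 * t) ^ 2 / (2 * ((2 : NNReal) : ℝ))) := by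
      rw [← exp_add, ← exp_add]; congr 1; push_cast; ring
    rw [mul_assoc, h3]
    have : √2 ≠ 0 := by positivity
    have : √(2 * π) ≠ 0 := by positivity
    field_simp
  simp_rw [this]
  rw [lintegral_const_mul _ (by fun_prop), lintegral_gaussianPDF_eq_one _ two_ne_zero, mul_one]

lemma aux_exp_sum {V : Type} (s : Finset V) (f : V → ℝ) :
    ENNReal.ofReal (exp (∑ i ∈ s, f i)) = ∏ i ∈ s, ENNReal.ofReal (exp (f i)) := by
  rw [exp_sum, ENNReal.ofReal_prod_of_nonneg (fun _ _ => (exp_pos _).le)]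

lemma aux_vec (N : ℕ) (w : ℝ) (hw : w = 0 ∨ w = 1 / 4) (s : ℝ) (hs0 : 0 ≤ s) (hs : s ≤ 1 / 2)
    (v : Fin N → ℝ) :
    ∫⁻ u : Fin N → ℝ, ENNReal.ofReal (exp (s * ∑ i, u i * v i + w * ∑ i, u i ^ 2))
        ∂(Measure.pi fun _ : Fin N => gaussianReal 0 1)
      ≤ ∫⁻ u : Fin N → ℝ, ENNReal.ofReal (exp (1 / 4 * ∑ i, v i ^ 2 + w * ∑ i, u i ^ 2))
        ∂(Measure.pi fun _ : Fin N => gaussianReal 0 1) := by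
  have e1 : ∀ u : Fin N → ℝ, ENNReal.ofReal (exp (s * ∑ i, u i * v i + w * ∑ i, u i ^ 2))
      = ∏ i, ENNReal.ofReal (exp ((s * v i) * u i + w * u i ^ 2)) := by
    intro u
    rw [← aux_exp_sum, Finset.sum_add_distrib, Finset.mul_sum, Finset.mul_sum]
    congr 3
    exact Finset.sum_congr rfl fun i _ => by ring
  have e2 : ∀ u : Fin N → ℝ, ENNReal.ofReal (exp (1 / 4 * ∑ i, v i ^ 2 + w * ∑ i, u i ^ 2))
      = ∏ i, ENNReal.ofReal (exp (v i ^ 2 / 4 + w * u i ^ 2)) := by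
    intro u
    rw [← aux_exp_sum, Finset.sum_add_distrib, Finset.mul_sum, Finset.mul_sum]
    congr 3
    exact Finset.sum_congr rfl fun i _ => by ring
  simp_rw [e1, e2]
  rw [aux_lintegral_pi_prod _ (fun i x => ENNReal.ofReal (exp ((s * v i) * x + w * x ^ 2)))
      (fun i => by fun_prop),
    aux_lintegral_pi_prod _ (fun i x => ENNReal.ofReal (exp (v i ^ 2 / 4 + w * x ^ 2)))
      (fun i => by fun_prop)]
  refine Finset.prod_le_prod' fun i _ => ?_
  have hsv : (s * v i) ^ 2 ≤ v i ^ 2 / 4 := by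
    have : s ^ 2 ≤ 1 / 4 := by nlinarith
    nlinarith [mul_le_mul_of_nonneg_right this (sq_nonneg (v i))]
  rcases hw with rfl | rfl
  · simp only [zero_mul, add_zero]
    rw [aux_gauss0]
    simp only [lintegral_const, measure_univ, mul_one]
    apply ENNReal.ofReal_le_ofReal
    apply exp_le_exp.2
    nlinarith [sq_nonneg (s * v i)]
  · have h1 := aux_gauss1 (s * v i)
    have h0 := aux_gauss1 0
    have : ∀ x : ℝ, (1 / 4 : ℝ) * x ^ 2 = x ^ 2 / 4 := fun x => by ring
    simp_rw [this]
    rw [h1]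
    simp_rw [exp_add (v i ^ 2 / 4), ENNReal.ofReal_mul (exp_pos (v i ^ 2 / 4)).le]
    rw [lintegral_const_mul _ (by fun_prop)]
    simp only [zero_mul, zero_add] at h0
    rw [h0, ← ENNReal.ofReal_mul (by positivity)]
    apply ENNReal.ofReal_le_ofReal
    norm_num
    rw [mul_comm]
    gcongr

lemma aux_vec_norm (N : ℕ) :
    ∫⁻ u : Fin N → ℝ, ENNReal.ofReal (exp (1 / 4 * ∑ i, u i ^ 2))
        ∂(Measure.pi fun _ : Fin N => gaussianReal 0 1) = ENNReal.ofReal (√2) ^ N := by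
  have e1 : ∀ u : Fin N → ℝ, ENNReal.ofReal (exp (1 / 4 * ∑ i, u i ^ 2))
      = ∏ i, ENNReal.ofReal (exp (0 * u i + u i ^ 2 / 4)) := by
    intro u
    rw [← aux_exp_sum, Finset.mul_sum]
    congr 3
    exact funext fun i => by ring
  simp_rw [e1]
  rw [aux_lintegral_pi_prod _ (fun i x => ENNReal.ofReal (exp (0 * x + x ^ 2 / 4)))
      (fun i => by fun_prop)]
  rw [aux_gauss1]
  simp

lemma aux_orth {N : ℕ} (A : Matrix (Fin N) (Fin N) ℝ) (hA : A ∈ Matrix.orthogonalGroup (Fin N) ℝ)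
    (v : Fin N → ℝ) : ∑ i, (A.mulVec v) i ^ 2 = ∑ i, v i ^ 2 := by
  have h := (Matrix.mem_orthogonalGroup_iff' (Fin N) ℝ).1 hA
  have : A.mulVec v ⬝ᵥ A.mulVec v = v ⬝ᵥ v := by
    rw [Matrix.dotProduct_mulVec, ← Matrix.mulVec_transpose, Matrix.mulVec_mulVec]

    rw [h, Matrix.one_mulVec]
  simpa [dotProduct, sq] using this

lemma aux_chain {V : Type} [Fintype V] [DecidableEq V] (N : ℕ) (E : Finset V) (nx : V → V)
    (inj : Set.InjOn nx E) (r : V → ℕ) (hr : ∀ x ∈ E, r x < r (nx x))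
    (G : V → Matrix (Fin N) (Fin N) ℝ) (hG : ∀ x ∈ E, G x ∈ Matrix.orthogonalGroup (Fin N) ℝ)
    (s : ℝ) (hs0 : 0 ≤ s) (hs : s ≤ 1 / 2) :
    ∫⁻ φ : V → Fin N → ℝ,
      ENNReal.ofReal (exp (s * ∑ x ∈ E, ∑ i, φ x i * (G x).mulVec (φ (nx x)) i))
      ∂(Measure.pi fun _ : V => Measure.pi fun _ : Fin N => gaussianReal 0 1)
    ≤ ENNReal.ofReal (√2) ^ (N * E.card) := by
  have key : ∀ S : Finset V, S ⊆ E → ∫⁻ φ : V → Fin N → ℝ,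
      ENNReal.ofReal (exp (s * ∑ x ∈ S, ∑ i, φ x i * (G x).mulVec (φ (nx x)) i
        + 1 / 4 * ∑ x ∈ E \ S, ∑ i, φ (nx x) i ^ 2))
      ∂(Measure.pi fun _ : V => Measure.pi fun _ : Fin N => gaussianReal 0 1)
      ≤ ENNReal.ofReal (√2) ^ (N * E.card) := by
    intro S
    induction S using Finset.induction_on_min_value r with
    | empty =>
      intro _
      have e : ∀ φ : V → Fin N → ℝ, ENNReal.ofReal (exp (s * ∑ x ∈ ∅, ∑ i, φ x i * (G x).mulVec (φ (nx x)) i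
        + 1 / 4 * ∑ x ∈ E \ ∅, ∑ i, φ (nx x) i ^ 2))
        = ∏ y, (if y ∈ E.image nx then ENNReal.ofReal (exp (1 / 4 * ∑ i, φ y i ^ 2)) else 1) := by
        intro φ
        rw [Finset.prod_ite_mem, Finset.univ_inter, Finset.prod_image inj, ← aux_exp_sum]
        simp [Finset.mul_sum]
      simp_rw [e]
      rw [aux_lintegral_pi_prod (V := V) (X := Fin N → ℝ) _
        (fun y u => if y ∈ E.image nx then ENNReal.ofReal (exp (1 / 4 * ∑ i, u i ^ 2)) else 1)
        (fun y => by split_ifs <;> fun_prop)]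
      have e2 : ∀ y, ∫⁻ u : Fin N → ℝ, (if y ∈ E.image nx then ENNReal.ofReal (exp (1 / 4 * ∑ i, u i ^ 2)) else 1) ∂(Measure.pi fun _ : Fin N => gaussianReal 0 1)
        = if y ∈ E.image nx then ENNReal.ofReal (√2) ^ N else 1 := by
        intro y
        split_ifs
        · exact aux_vec_norm N
        · simp
      simp_rw [e2]
      rw [Finset.prod_ite_mem, Finset.univ_inter, Finset.prod_image inj, Finset.prod_const, pow_mul]
    | insert x S hxS hmin ih =>
      intro hsub
      have hxE : x ∈ E := hsub (Finset.mem_insert_self _ _)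
      have hSE : S ⊆ E := fun z hz => hsub (Finset.mem_insert_of_mem hz)
      refine le_trans ?_ (ih hSE)
      refine lintegral_le_of_lmarginal_le {x} ?_ ?_ ?_
      · simp only [Matrix.mulVec, dotProduct]; fun_prop
      · simp only [Matrix.mulVec, dotProduct]; fun_prop
      rw [lmarginal_singleton, lmarginal_singleton]
      intro φ
      have hnx : nx x ≠ x := fun h => by have := hr x hxE; rw [h] at this; omega
      have hEd : E \ S = insert x (E \ insert x S) := by
        ext z; simp only [Finset.mem_sdiff, Finset.mem_insert]
        by_cases h : z = x
        · subst h; simp [hxE, hxS]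
        · simp [h]
      have hxn : x ∉ E \ insert x S := by simp
      set D := E \ insert x S with hD
      set v := (G x).mulVec (φ (nx x)) with hv
      set c := s * ∑ z ∈ S, ∑ i, φ z i * (G z).mulVec (φ (nx z)) i
        + 1 / 4 * ∑ z ∈ D with nx z ≠ x, ∑ i, φ (nx z) i ^ 2 with hc
      set w : ℝ := 1 / 4 * ((D.filter (fun z => nx z = x)).card : ℝ) with hw
      have hw' : w = 0 ∨ w = 1 / 4 := by
        have : (D.filter (fun z => nx z = x)).card ≤ 1 := by
          rw [Finset.card_le_one]
          intro a ha b hb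
          simp only [Finset.mem_filter, hD, Finset.mem_sdiff] at ha hb
          exact inj ha.1.1 hb.1.1 (ha.2.trans hb.2.symm)
        interval_cases h : (D.filter (fun z => nx z = x)).card
        · left; simp [hw]
        · right; simp [hw]
      have sS : ∀ u : Fin N → ℝ, ∑ z ∈ S, ∑ i, Function.update φ x u z i * (G z).mulVec (Function.update φ x u (nx z)) i = ∑ z ∈ S, ∑ i, φ z i * (G z).mulVec (φ (nx z)) i := by
        intro u
        refine Finset.sum_congr rfl fun z hz => ?_
        have h1 : z ≠ x := fun h => hxS (h ▸ hz)
        have h2 : nx z ≠ x := fun h => by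
          have a := hr z (hSE hz); have b := hmin z hz; rw [h] at a; omega
        rw [Function.update_of_ne h1, Function.update_of_ne h2]
      have sD : ∀ u : Fin N → ℝ, 1 / 4 * ∑ z ∈ D, ∑ i, Function.update φ x u (nx z) i ^ 2
          = w * ∑ i, u i ^ 2 + 1 / 4 * ∑ z ∈ D with nx z ≠ x, ∑ i, φ (nx z) i ^ 2 := by
        intro u
        rw [← Finset.sum_filter_add_sum_filter_not D (fun z => nx z = x), mul_add]
        congr 1
        · rw [Finset.sum_congr rfl (g := fun _ => ∑ i, u i ^ 2)]
          · rw [Finset.sum_const, nsmul_eq_mul, hw]; ring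
          · intro z hz
            rw [(Finset.mem_filter.1 hz).2, Function.update_self]
        · congr 1
          refine Finset.sum_congr rfl fun z hz => ?_
          rw [Function.update_of_ne (Finset.mem_filter.1 hz).2]
      have l1 : ∀ u : Fin N → ℝ, ENNReal.ofReal (exp (s * ∑ z ∈ insert x S, ∑ i, Function.update φ x u z i * (G z).mulVec (Function.update φ x u (nx z)) i
          + 1 / 4 * ∑ z ∈ D, ∑ i, Function.update φ x u (nx z) i ^ 2))
          = ENNReal.ofReal (exp c) * ENNReal.ofReal (exp (s * ∑ i, u i * v i + w * ∑ i, u i ^ 2)) := by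
        intro u
        rw [sD, Finset.sum_insert hxS, sS, ← ENNReal.ofReal_mul (exp_pos _).le, ← exp_add,
          Function.update_self, Function.update_of_ne hnx]
        congr 2
        rw [hc]; ring
      have l2 : ∀ u : Fin N → ℝ, ENNReal.ofReal (exp (s * ∑ z ∈ S, ∑ i, Function.update φ x u z i * (G z).mulVec (Function.update φ x u (nx z)) i
          + 1 / 4 * ∑ z ∈ E \ S, ∑ i, Function.update φ x u (nx z) i ^ 2))
          = ENNReal.ofReal (exp c) * ENNReal.ofReal (exp (1 / 4 * ∑ i, v i ^ 2 + w * ∑ i, u i ^ 2)) := by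
        intro u
        rw [hEd, Finset.sum_insert hxn, mul_add (1 / 4 : ℝ), sD, sS, ← ENNReal.ofReal_mul (exp_pos _).le, ← exp_add,
          Function.update_of_ne hnx, hv, aux_orth _ (hG x hxE)]
        congr 2
        rw [hc]; ring
      simp only [l1, l2]
      rw [lintegral_const_mul _ (by fun_prop), lintegral_const_mul _ (by fun_prop)]
      exact mul_le_mul_right (aux_vec N w hw' s hs0 hs v) _
  have := key E le_rfl
  simpa using this

lemma aux_card (d L : ℕ) (hd : 1 ≤ d) (hL : 2 ≤ L) (μ : Fin d) :
    (Finset.univ.filter (fun x : Fin d → Fin L => (x μ : ℕ) + 1 < L)).card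
      = (L - 1) * L ^ (d - 1) := by
  have : (Finset.univ.filter (fun x : Fin d → Fin L => (x μ : ℕ) + 1 < L))
      = Fintype.piFinset (fun ν : Fin d => if ν = μ then
          Finset.univ.filter (fun k : Fin L => (k : ℕ) + 1 < L) else Finset.univ) := by
    ext x
    simp only [Finset.mem_filter, Finset.mem_univ, true_and, Fintype.mem_piFinset]
    constructor
    · intro h ν
      split_ifs with hν
      · subst hν; simpa using h
      · simp
    · intro h
      simpa using h μ
  have hc : (Finset.univ.filter (fun k : Fin L => (k : ℕ) + 1 < L)).card = L - 1 := by
    have h : (Finset.univ.filter (fun k : Fin L => (k : ℕ) + 1 < L))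
      = Finset.univ.erase ⟨L - 1, by omega⟩ := by
      ext k; simp [Fin.ext_iff]; omega
    rw [h, Finset.card_erase_of_mem (Finset.mem_univ _)]; simp
  rw [this, Fintype.card_piFinset, ← Finset.mul_prod_erase _ _ (Finset.mem_univ μ)]
  rw [if_pos rfl, hc]
  congr 1
  rw [Finset.prod_congr rfl (g := fun _ => L)]
  · simp
  · intro ν hν
    rw [if_neg (Finset.ne_of_mem_erase hν)]; simp

lemma aux_dir (d L N : ℕ) (hd : 1 ≤ d) (hL : 2 ≤ L)
    (g : (Fin d → Fin L) → Fin d → Matrix (Fin N) (Fin N) ℝ)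
    (hg : ∀ (x : Fin d → Fin L) (μ : Fin d), (x μ : ℕ) + 1 < L →
      g x μ ∈ Matrix.orthogonalGroup (Fin N) ℝ) (s : ℝ) (hs0 : 0 ≤ s) (hs : s ≤ 1 / 2)
    (μ : Fin d) :
    ∫⁻ φ : (Fin d → Fin L) → Fin N → ℝ,
      ENNReal.ofReal (exp (s * ∑ x : Fin d → Fin L,
        if h : (x μ : ℕ) + 1 < L then
        ∑ i, φ x i * (g x μ).mulVec (φ (Function.update x μ ⟨(x μ : ℕ) + 1, h⟩)) i
        else 0))
      ∂(Measure.pi fun _ : Fin d → Fin L => Measure.pi fun _ : Fin N => gaussianReal 0 1)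
    ≤ ENNReal.ofReal (√2) ^ (N * ((L - 1) * L ^ (d - 1))) := by
  set E := Finset.univ.filter (fun x : Fin d → Fin L => (x μ : ℕ) + 1 < L) with hE
  set nx : (Fin d → Fin L) → (Fin d → Fin L) := fun x =>
    if h : (x μ : ℕ) + 1 < L then Function.update x μ ⟨(x μ : ℕ) + 1, h⟩ else x with hnx
  have hmem : ∀ x, x ∈ E ↔ (x μ : ℕ) + 1 < L := fun x => by simp [hE]
  have hnx1 : ∀ x (h : (x μ : ℕ) + 1 < L), nx x = Function.update x μ ⟨(x μ : ℕ) + 1, h⟩ :=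
    fun x h => by simp only [hnx, dif_pos h]
  have inj : Set.InjOn nx E := by
    intro x hx y hy hxy
    have hx' := (hmem x).1 hx
    have hy' := (hmem y).1 hy
    rw [hnx1 x hx', hnx1 y hy'] at hxy
    funext ν
    have := congrFun hxy ν
    by_cases h : ν = μ
    · subst h
      simp [Fin.ext_iff] at this
      exact Fin.ext this
    · simpa [Function.update_of_ne h] using this
  have := aux_chain N E nx inj (fun x => (x μ : ℕ)) (fun x hx => by
    have hx' := (hmem x).1 hx
    simp [hnx1 x hx']) (fun x => g x μ) (fun x hx => hg x μ ((hmem x).1 hx)) s hs0 hs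
  rw [aux_card d L hd hL μ] at this
  refine le_trans (le_of_eq ?_) this
  refine lintegral_congr fun φ => ?_
  congr 3
  rw [hE, Finset.sum_filter]
  refine Finset.sum_congr rfl fun x _ => ?_
  split_ifs with h
  · rw [hnx1 x h]
  · rfl

lemma aux_upper (d L N : ℕ) (hd : 1 ≤ d) (hL : 2 ≤ L)
    (g : (Fin d → Fin L) → Fin d → Matrix (Fin N) (Fin N) ℝ)
    (hg : ∀ (x : Fin d → Fin L) (μ : Fin d), (x μ : ℕ) + 1 < L →
      g x μ ∈ Matrix.orthogonalGroup (Fin N) ℝ)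
    (κ2 : ℝ) (hκ0 : 0 ≤ κ2) (hκ : κ2 ≤ 1 / (2 * d)) :
    bosePartition d L N g κ2 ≤ ENNReal.ofReal (√2) ^ (N * ((L - 1) * L ^ (d - 1))) := by
  have hd0 : (0 : ℝ) < d := by exact_mod_cast hd
  have hs0 : 0 ≤ d * κ2 := by positivity
  have hs : d * κ2 ≤ 1 / 2 := by
    calc d * κ2 ≤ d * (1 / (2 * d)) := by gcongr
      _ = 1 / 2 := by field_simp
  set h : Fin d → ((Fin d → Fin L) → Fin N → ℝ) → ℝ := fun μ φ => ∑ x : Fin d → Fin L,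
        if h : (x μ : ℕ) + 1 < L then
        ∑ i, φ x i * (g x μ).mulVec (φ (Function.update x μ ⟨(x μ : ℕ) + 1, h⟩)) i
        else 0 with hh
  have hmeas : ∀ μ, Measurable (h μ) := by
    intro μ
    refine Finset.measurable_fun_sum _ fun x _ => ?_
    split_ifs
    · simp only [Matrix.mulVec, dotProduct]; fun_prop
    · fun_prop
  have e : ∀ φ, ENNReal.ofReal (exp (κ2 * hoppingSum d L N g φ))
      = ∏ μ, ENNReal.ofReal (exp (d * κ2 * h μ φ)) ^ (1 / d : ℝ) := by
    intro φ
    have : κ2 * hoppingSum d L N g φ = ∑ μ, κ2 * h μ φ := by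
      rw [← Finset.mul_sum]; rfl
    rw [this, aux_exp_sum]
    refine Finset.prod_congr rfl fun μ _ => ?_
    rw [ENNReal.ofReal_rpow_of_pos (exp_pos _), ← exp_mul]
    congr 2
    field_simp
  unfold bosePartition
  simp_rw [e]
  refine (ENNReal.lintegral_prod_norm_pow_le Finset.univ (fun μ _ => ?_) ?_ ?_).trans ?_
  · have := hmeas μ
    fun_prop
  · simp; field_simp
  · intro _ _; positivity
  · calc _ ≤ ∏ μ : Fin d, (ENNReal.ofReal (√2) ^ (N * ((L - 1) * L ^ (d - 1)))) ^ (1 / d : ℝ) := by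
          refine Finset.prod_le_prod' fun μ _ => ?_
          exact ENNReal.rpow_le_rpow (aux_dir d L N hd hL g hg _ hs0 hs μ) (by positivity)
      _ = _ := by
          rw [Finset.prod_const, Finset.card_univ, Fintype.card_fin, ← ENNReal.rpow_natCast, ← ENNReal.rpow_mul]
          rw [one_div, inv_mul_cancel₀ hd0.ne', ENNReal.rpow_one]

lemma aux_lower (d L N : ℕ)
    (g : (Fin d → Fin L) → Fin d → Matrix (Fin N) (Fin N) ℝ) (κ2 : ℝ) :
    1 ≤ bosePartition d L N g κ2 := by
  set P : Measure ((Fin d → Fin L) → Fin N → ℝ) :=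
    Measure.pi fun _ : Fin d → Fin L => Measure.pi fun _ : Fin N => gaussianReal 0 1 with hP
  set ε : (Fin d → Fin L) → ℝ := fun x => (-1) ^ (∑ ν, (x ν : ℕ)) with hε
  have hmp : MeasurePreserving (fun (φ : (Fin d → Fin L) → Fin N → ℝ) x i => ε x * φ x i) P P := by
    refine measurePreserving_pi _ _ (f := fun x (u : Fin N → ℝ) i => ε x * u i) fun x => ?_
    refine measurePreserving_pi _ _ (f := fun i (t : ℝ) => ε x * t) fun i => ?_
    rcases neg_one_pow_eq_or ℝ (∑ ν, (x ν : ℕ)) with h | h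
    · simp only [hε, h, one_mul]; exact MeasurePreserving.id _
    · simp only [hε, h, neg_one_mul]
      exact ⟨measurable_neg, by have := gaussianReal_map_neg (μ := 0) (v := 1); simpa using this⟩
  have hmeas : Measurable (hoppingSum d L N g) := by
    unfold hoppingSum
    refine Finset.measurable_fun_sum _ fun μ _ => Finset.measurable_fun_sum _ fun x _ => ?_
    split_ifs
    · simp only [Matrix.mulVec, dotProduct]; fun_prop
    · fun_prop
  have hflip : ∀ φ, hoppingSum d L N g (fun x i => ε x * φ x i) = - hoppingSum d L N g φ := by
    intro φ
    unfold hoppingSum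
    rw [← Finset.sum_neg_distrib]
    refine Finset.sum_congr rfl fun μ _ => ?_
    rw [← Finset.sum_neg_distrib]
    refine Finset.sum_congr rfl fun x _ => ?_
    split_ifs with h
    · rw [← Finset.sum_neg_distrib]
      refine Finset.sum_congr rfl fun i _ => ?_
      set y := Function.update x μ ⟨(x μ : ℕ) + 1, h⟩ with hy
      have h1 : ∑ ν, (y ν : ℕ) = ∑ ν, (x ν : ℕ) + 1 := by
        rw [← Finset.add_sum_erase _ _ (Finset.mem_univ μ),
          ← Finset.add_sum_erase _ (fun ν => (x ν : ℕ)) (Finset.mem_univ μ)]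
        have : ∑ ν ∈ Finset.univ.erase μ, (y ν : ℕ) = ∑ ν ∈ Finset.univ.erase μ, (x ν : ℕ) :=
          Finset.sum_congr rfl fun ν hν => by
            rw [hy, Function.update_of_ne (Finset.ne_of_mem_erase hν)]
        rw [this, hy, Function.update_self]; simp; ring
      have h2 : ε x * ε y = -1 := by
        simp only [hε]
        rw [h1, pow_succ, ← mul_assoc, ← mul_pow]; simp
      have h3 : (fun i => ε y * φ y i) = ε y • φ y := rfl
      beta_reduce
      rw [h3, Matrix.mulVec_smul, Pi.smul_apply, smul_eq_mul]
      linear_combination (φ x i * (g x μ).mulVec (φ y) i) * h2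
    · simp
  have hf : Measurable fun φ => ENNReal.ofReal (exp (κ2 * hoppingSum d L N g φ)) := by fun_prop
  have hZ : bosePartition d L N g κ2
      = ∫⁻ φ, ENNReal.ofReal (exp (-(κ2 * hoppingSum d L N g φ))) ∂P := by
    unfold bosePartition
    rw [← hP, ← hmp.lintegral_comp hf]
    refine lintegral_congr fun φ => ?_
    rw [hflip, mul_neg]
  have h2 : 2 ≤ bosePartition d L N g κ2 + bosePartition d L N g κ2 := by
    conv_rhs => rw [hZ]
    conv_rhs => 
      arg 1
      rw [← hZ]
    unfold bosePartition
    rw [← hP, ← lintegral_add_left hf]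
    calc (2 : ℝ≥0∞) = ∫⁻ φ, 2 ∂P := by simp
      _ ≤ _ := by
        refine lintegral_mono fun φ => ?_
        rw [← ENNReal.ofReal_add (exp_pos _).le (exp_pos _).le]
        have : (2 : ℝ≥0∞) = ENNReal.ofReal 2 := by simp
        rw [this]
        apply ENNReal.ofReal_le_ofReal
        have a := add_one_le_exp (κ2 * hoppingSum d L N g φ)
        have b := add_one_le_exp (-(κ2 * hoppingSum d L N g φ))
        linarith
  by_contra hlt
  push Not at hlt
  have := ENNReal.add_lt_add hlt hlt
  rw [one_add_one_eq_two] at this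
  exact absurd h2 (not_le.2 this)

/-- the paper's Theorem 1, real Bose fields, gauge group `O(N)`:
for any gauge configuration `g` of orthogonal matrices on the bonds of the hypercubic
lattice `{1,…,L}^d` and any `0 ≤ κ² ≤ 1/(2d)`, the scaled Bose-gauge partition function
satisfies `1 ≤ Z ≤ 2^{N(L−1)L^{d−1}/2}`; in particular `Z ≤ e^{c_u L^d}` with
`c_u = (N ln 2)/2` independent of `L`, `κ²` and the gauge configuration. -/
theorem bose_gauge_stability_bounds (d L N : ℕ) (hd : 1 ≤ d) (hL : 2 ≤ L) (hN : 1 ≤ N)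
    (g : (Fin d → Fin L) → Fin d → Matrix (Fin N) (Fin N) ℝ)
    (hg : ∀ (x : Fin d → Fin L) (μ : Fin d), (x μ : ℕ) + 1 < L →
      g x μ ∈ Matrix.orthogonalGroup (Fin N) ℝ)
    (κ2 : ℝ) (hκ0 : 0 ≤ κ2) (hκ : κ2 ≤ 1 / (2 * d)) :
    1 ≤ bosePartition d L N g κ2 ∧
    bosePartition d L N g κ2
      ≤ ENNReal.ofReal ((2 : ℝ) ^ (((N * (L - 1) * L ^ (d - 1) : ℕ) : ℝ) / 2)) ∧
    bosePartition d L N g κ2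
      ≤ ENNReal.ofReal (Real.exp ((N * Real.log 2 / 2) * (L ^ d : ℕ))) := by
  have hU : bosePartition d L N g κ2
      ≤ ENNReal.ofReal ((2 : ℝ) ^ (((N * (L - 1) * L ^ (d - 1) : ℕ) : ℝ) / 2)) := by
    refine (aux_upper d L N hd hL g hg κ2 hκ0 hκ).trans (le_of_eq ?_)
    rw [← ENNReal.ofReal_pow (by positivity), ← mul_assoc, Real.sqrt_eq_rpow,
      ← Real.rpow_natCast, ← Real.rpow_mul (by norm_num)]
    congr 2
    ring
  refine ⟨aux_lower d L N g κ2, hU, hU.trans (ENNReal.ofReal_le_ofReal ?_)⟩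
  rw [Real.rpow_def_of_pos (by norm_num)]
  apply exp_le_exp.2
  have h1 : N * (L - 1) * L ^ (d - 1) ≤ N * L ^ d := by
    have : L ^ d = L * L ^ (d - 1) := by rw [← pow_succ']; congr 1; omega
    rw [this, ← mul_assoc]
    gcongr
    omega
  have h2 : ((N * (L - 1) * L ^ (d - 1) : ℕ) : ℝ) ≤ N * (L ^ d : ℕ) := by exact_mod_cast h1
  have h3 : 0 < Real.log 2 := Real.log_pos (by norm_num)
  nlinarith [mul_le_mul_of_nonneg_left h2 h3.le]
end

section
/- Let N ≥ 1 and d ∈ {2, 3, 4}. There is a finite constant C = C(N) > 0, depending only on N, such that for all lattice spacings a ∈ (0,1] and all gauge couplings g² > 0, the single-bond pure-gauge partition function z(a, g²) = ∫_{U(N)} exp( −(a^{d−4}/g²)·‖1 − U‖²_F ) dμ(U) satisfies z(a, g²) ≤ C · (g² a^{4−d})^{N²/2}, where μ is the normalized (probability) Haar measure on the group U(N) of N×N complex unitary matrices and ‖·‖_F is the Frobenius norm. -/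
open Real MeasureTheory Matrix

/-- The squared Frobenius (Hilbert–Schmidt) norm of a complex matrix:
`‖A‖²_F = Tr(AᴴA)` (which is a real number). -/
noncomputable def frobSq {N : ℕ} (A : Matrix (Fin N) (Fin N) ℂ) : ℝ :=
  (Matrix.trace (Aᴴ * A)).re

/-- The Borel σ-algebra on the unitary group `U(N)`. -/
noncomputable instance unitaryGroupMeasurableSpace {N : ℕ} :
    MeasurableSpace (Matrix.unitaryGroup (Fin N) ℂ) := borel _

section FrobAux
attribute [local instance] Matrix.frobeniusNormedRing Matrix.frobeniusNormedAddCommGroup Matrix.frobeniusNormedSpace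

lemma frobSq_eq_sum {N : ℕ} (A : Matrix (Fin N) (Fin N) ℂ) :
    frobSq A = ∑ i, ∑ j, ‖A i j‖ ^ 2 := by
  unfold frobSq
  rw [Finset.sum_comm]
  simp only [Matrix.trace, Matrix.diag, Matrix.mul_apply, Matrix.conjTranspose_apply, Complex.re_sum]
  refine Finset.sum_congr rfl fun i _ => Finset.sum_congr rfl fun j _ => ?_
  rw [← Complex.normSq_eq_norm_sq, Complex.normSq_apply]
  simp [Complex.mul_re]

lemma frobSq_eq_norm {N : ℕ} (A : Matrix (Fin N) (Fin N) ℂ) :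
    frobSq A = ‖A‖ ^ 2 := by
  rw [frobSq_eq_sum, Matrix.frobenius_norm_def, ← Real.sqrt_eq_rpow, Real.sq_sqrt (by positivity)]
  simp

lemma aux_norm_one_sub {N : ℕ} (R : ℝ) (X : Matrix (Fin N) (Fin N) ℂ)
    (hX : frobSq X ≤ R ^ 2) (hR : 0 ≤ R) : ‖1 - X‖ ≤ ‖(1 : Matrix (Fin N) (Fin N) ℂ)‖ + R := by
  rw [frobSq_eq_norm] at hX
  have := abs_le_of_sq_le_sq hX hR
  exact (norm_sub_le _ _).trans (by linarith [(abs_le.1 this).2])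

/-- Lower Lipschitz bound for the Cayley transform. -/
lemma aux_lower_s14 (N : ℕ) (R : ℝ) (hR : 0 ≤ R) : ∃ K : ℝ, 0 < K ∧
    ∀ X Y U V : Matrix (Fin N) (Fin N) ℂ, frobSq X ≤ R ^ 2 → frobSq Y ≤ R ^ 2 →
      (1 - X) * (U + 1) = 2 → (V + 1) * (1 - Y) = 2 →
      ∀ r : ℝ, 0 ≤ r → ∀ W : Matrix (Fin N) (Fin N) ℂ, frobSq (W - U) ≤ r ^ 2 →
        frobSq (W - V) ≤ r ^ 2 → frobSq (X - Y) ≤ (K * r) ^ 2 := by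
  set c : ℝ := ‖(1 : Matrix (Fin N) (Fin N) ℂ)‖ + R + 1 with hc
  have hc0 : 0 < c := by positivity
  refine ⟨c * c, by positivity, ?_⟩
  intro X Y U V hX hY hU hV r hr W hWU hWV
  have h1 : ‖1 - X‖ ≤ c := (aux_norm_one_sub R X hX hR).trans (by linarith)
  have h2 : ‖1 - Y‖ ≤ c := (aux_norm_one_sub R Y hY hR).trans (by linarith)
  rw [frobSq_eq_norm] at hWU hWV ⊢
  have h3 := (abs_le.1 (abs_le_of_sq_le_sq hWU hr)).2
  have h4 := (abs_le.1 (abs_le_of_sq_le_sq hWV hr)).2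
  have h5 : ‖U - V‖ ≤ 2 * r := by
    have : U - V = (W - V) - (W - U) := by abel
    rw [this]
    exact (norm_sub_le _ _).trans (by linarith)
  have key : (1 - X) * (U - V) * (1 - Y) = (X - Y) + (X - Y) := by
    have : (1 - X) * (U - V) * (1 - Y)
      = ((1 - X) * (U + 1)) * (1 - Y) - (1 - X) * ((V + 1) * (1 - Y)) := by noncomm_ring
    rw [this, hU, hV]
    noncomm_ring
  have h6 : ‖(X - Y) + (X - Y)‖ = 2 * ‖X - Y‖ := by
    rw [← two_smul ℝ, norm_smul]; simp
  have h7 : ‖(1 - X) * (U - V) * (1 - Y)‖ ≤ c * (2 * r) * c := by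
    refine (norm_mul_le _ _).trans ?_
    refine mul_le_mul ((norm_mul_le _ _).trans ?_) h2 (norm_nonneg _) (by positivity)
    exact mul_le_mul h1 h5 (norm_nonneg _) hc0.le
  rw [key, h6] at h7
  have : ‖X - Y‖ ≤ c * c * r := by linarith
  gcongr

end FrobAux

open scoped ComplexOrder in
lemma cayley_exists {N : ℕ} (X : Matrix (Fin N) (Fin N) ℂ) (hX : Xᴴ = -X) :
    ∃ U : Matrix.unitaryGroup (Fin N) ℂ, (1 - X) * ((U : Matrix (Fin N) (Fin N) ℂ) + 1) = 2 ∧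
      ((U : Matrix (Fin N) (Fin N) ℂ) + 1) * (1 - X) = 2 := by
  have hpd : (1 + Xᴴ * X).PosDef :=
    Matrix.PosDef.one.add_posSemidef (Matrix.posSemidef_conjTranspose_mul_self X)
  have hu : IsUnit (1 + Xᴴ * X) := hpd.isUnit
  have hf : 1 + Xᴴ * X = (1 + X) * (1 - X) := by rw [hX]; noncomm_ring
  have hf2 : (1 + X) * (1 - X) = (1 - X) * (1 + X) := by noncomm_ring
  rw [hf, Matrix.isUnit_iff_isUnit_det, Matrix.det_mul, IsUnit.mul_iff] at hu
  set A := (1 - X)⁻¹ with hA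
  set B := (1 + X)⁻¹ with hB
  have a1 : A * (1 - X) = 1 := Matrix.nonsing_inv_mul _ hu.2
  have a2 : (1 - X) * A = 1 := Matrix.mul_nonsing_inv _ hu.2
  have b1 : B * (1 + X) = 1 := Matrix.nonsing_inv_mul _ hu.1
  have hAB : Aᴴ = B := by
    rw [hA, Matrix.conjTranspose_nonsing_inv]; simp [hX, hB]
  have hUm : (1 + X) * A ∈ Matrix.unitaryGroup (Fin N) ℂ := by
    rw [Matrix.mem_unitaryGroup_iff', Matrix.star_eq_conjTranspose, Matrix.conjTranspose_mul, hAB]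
    have : (1 + X)ᴴ = 1 - X := by simp [hX, sub_eq_add_neg]
    rw [this]
    calc B * (1 - X) * ((1 + X) * A) = B * ((1 - X) * (1 + X)) * A := by noncomm_ring
      _ = (B * (1 + X)) * ((1 - X) * A) := by rw [← hf2]; noncomm_ring
      _ = 1 := by rw [b1, a2, one_mul]
  have e : (1 + X) * A + 1 = A + A := by
    have : (1 + X) * A + (1 - X) * A = A + A := by noncomm_ring
    rwa [a2] at this
  refine ⟨⟨(1 + X) * A, hUm⟩, ?_, ?_⟩
  · rw [e, mul_add, a2]; norm_num
  · rw [e, add_mul, a1]; norm_num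

/-- Linear parametrization of skew-Hermitian matrices by real matrices. -/
noncomputable def skewOf {N : ℕ} (T : Fin N → Fin N → ℝ) : Matrix (Fin N) (Fin N) ℂ :=
  Matrix.of fun i j => (⟨T i j - T j i, T i j + T j i⟩ : ℂ)

lemma skewOf_skew {N : ℕ} (T : Fin N → Fin N → ℝ) : (skewOf T)ᴴ = - skewOf T := by
  ext i j
  apply Complex.ext <;> simp [skewOf] <;> ring

lemma skewOf_bound {N : ℕ} (T : Fin N → Fin N → ℝ) (hT : ∀ i j, |T i j| ≤ 1) :
    frobSq (skewOf T) ≤ (4 * N : ℝ) ^ 2 := by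
  rw [frobSq_eq_sum]
  calc _ ≤ ∑ i : Fin N, ∑ j : Fin N, (16 : ℝ) := by
        refine Finset.sum_le_sum fun i _ => Finset.sum_le_sum fun j _ => ?_
        rw [← Complex.normSq_eq_norm_sq, Complex.normSq_apply]
        simp only [skewOf, Matrix.of_apply]
        have h1 := sq_le_one_iff_abs_le_one (T i j) |>.2 (hT i j)
        have h2 := sq_le_one_iff_abs_le_one (T j i) |>.2 (hT j i)
        nlinarith
    _ = _ := by simp; ring

lemma skewOf_lower {N : ℕ} (T S : Fin N → Fin N → ℝ) (i j : Fin N) :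
    (T i j - S i j) ^ 2 ≤ frobSq (skewOf T - skewOf S) := by
  rw [frobSq_eq_sum]
  have h1 : (T i j - S i j) ^ 2 ≤ ‖(skewOf T - skewOf S) i j‖ ^ 2 := by
    rw [← Complex.normSq_eq_norm_sq, Complex.normSq_apply]
    simp only [skewOf, Matrix.of_apply, Matrix.sub_apply, Complex.sub_re, Complex.sub_im]
    nlinarith [sq_nonneg (T i j - S i j), sq_nonneg (T j i - S j i)]
  refine h1.trans ?_
  refine le_trans ?_ (Finset.single_le_sum (f := fun i => ∑ j, ‖(skewOf T - skewOf S) i j‖ ^ 2)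
    (fun _ _ => by positivity) (Finset.mem_univ i))
  exact Finset.single_le_sum (f := fun j => ‖(skewOf T - skewOf S) i j‖ ^ 2)
    (fun _ _ => by positivity) (Finset.mem_univ j)

lemma frobSq_unitary {N : ℕ} (U : Matrix.unitaryGroup (Fin N) ℂ) (A : Matrix (Fin N) (Fin N) ℂ) :
    frobSq ((U : Matrix (Fin N) (Fin N) ℂ) * A) = frobSq A := by
  unfold frobSq
  have := Matrix.mem_unitaryGroup_iff'.1 U.2
  rw [Matrix.star_eq_conjTranspose] at this
  rw [Matrix.conjTranspose_mul, Matrix.mul_assoc, ← Matrix.mul_assoc _ (U : Matrix (Fin N) (Fin N) ℂ) A,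
    this, one_mul]

lemma frobSq_neg {N : ℕ} (A : Matrix (Fin N) (Fin N) ℂ) : frobSq (-A) = frobSq A := by
  simp [frobSq]

lemma frobSq_cont {N : ℕ} (B : Matrix (Fin N) (Fin N) ℂ) :
    Continuous fun U : Matrix.unitaryGroup (Fin N) ℂ => frobSq ((U : Matrix (Fin N) (Fin N) ℂ) - B) := by
  unfold frobSq
  have : Continuous fun U : Matrix.unitaryGroup (Fin N) ℂ => (U : Matrix (Fin N) (Fin N) ℂ) - B :=
    continuous_subtype_val.sub continuous_const
  exact Complex.continuous_re.comp ((this.matrix_conjTranspose.matrix_mul this).matrix_trace)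

instance unitaryGroupBorel {N : ℕ} : BorelSpace (Matrix.unitaryGroup (Fin N) ℂ) := ⟨rfl⟩

lemma ball_bound (N : ℕ) (μ : Measure (Matrix.unitaryGroup (Fin N) ℂ))
    [IsProbabilityMeasure μ] [μ.IsMulLeftInvariant] :
    ∃ K : ℝ, 0 < K ∧ ∀ r : ℝ, 0 < r → ∀ m : ℕ, 1 ≤ m → K * r * m < 1 →
      (m : ℝ) ^ (N ^ 2) * μ.real {U | frobSq ((U : Matrix (Fin N) (Fin N) ℂ) - 1) ≤ r ^ 2} ≤ 1 := by
  obtain ⟨K, hK, hKK⟩ := aux_lower_s14 N (4 * N) (by positivity)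
  refine ⟨K, hK, fun r hr m hm hlt => ?_⟩
  have hm0 : (0 : ℝ) < m := by exact_mod_cast hm
  let T : (Fin N → Fin N → Fin m) → Fin N → Fin N → ℝ := fun n i j => (n i j : ℝ) / m
  have hT : ∀ n i j, |T n i j| ≤ 1 := by
    intro n i j
    have : ((n i j : ℕ) : ℝ) ≤ m := by exact_mod_cast (n i j).2.le
    rw [abs_of_nonneg (by positivity)]
    exact (div_le_one hm0).2 this
  choose U hU1 hU2 using fun n => cayley_exists (skewOf (T n)) (skewOf_skew (T n))
  let S : (Fin N → Fin N → Fin m) → Set (Matrix.unitaryGroup (Fin N) ℂ) :=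
    fun n => {W | frobSq ((W : Matrix (Fin N) (Fin N) ℂ) - (U n : Matrix (Fin N) (Fin N) ℂ)) ≤ r ^ 2}
  have hSm : ∀ n, MeasurableSet (S n) := fun n =>
    (isClosed_le (frobSq_cont _) continuous_const).measurableSet
  have hdisj : Pairwise (Function.onFun Disjoint S) := by
    intro n n' hne
    rw [Function.onFun, Set.disjoint_left]
    intro W hW hW'
    apply hne
    have h := hKK _ _ _ _ (skewOf_bound _ (hT n)) (skewOf_bound _ (hT n')) (hU1 n) (hU2 n') r hr.le W
      hW hW'
    ext i j
    have h2 := (skewOf_lower (T n) (T n') i j).trans h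
    have h3 := abs_le_of_sq_le_sq h2 (by positivity)
    have h4 : |T n i j - T n' i j| * m < 1 := by
      refine lt_of_le_of_lt ?_ hlt
      gcongr
    have h5 : |((n i j : ℕ) : ℝ) - ((n' i j : ℕ) : ℝ)| < 1 := by
      rw [← abs_of_pos hm0, ← abs_mul] at h4
      have e1 : (T n i j - T n' i j) * m = ((n i j : ℕ) : ℝ) - ((n' i j : ℕ) : ℝ) := by
        simp only [T]; field_simp
      rwa [e1] at h4
    have h6 : |((n i j : ℕ) : ℤ) - ((n' i j : ℕ) : ℤ)| < 1 := by exact_mod_cast h5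
    rw [Int.abs_lt_one_iff] at h6
    omega
  have hinv : ∀ n, μ (S n) = μ {U | frobSq ((U : Matrix (Fin N) (Fin N) ℂ) - 1) ≤ r ^ 2} := by
    intro n
    rw [← measure_preimage_mul μ (U n) (S n)]
    congr 1
    ext W
    simp only [S, Set.mem_preimage, Set.mem_ofPred_eq]
    rw [← frobSq_unitary (U n) ((W : Matrix (Fin N) (Fin N) ℂ) - 1), mul_sub, mul_one]
    rfl
  have hsum : ∑ n, μ.real (S n) ≤ 1 := by
    rw [← measureReal_iUnion_fintype hdisj hSm]
    exact measureReal_le_one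
  have : ∀ n, μ.real (S n) = μ.real {U | frobSq ((U : Matrix (Fin N) (Fin N) ℂ) - 1) ≤ r ^ 2} :=
    fun n => by simp only [Measure.real, hinv n]
  simp only [this, Finset.sum_const, nsmul_eq_mul] at hsum
  convert hsum using 2
  simp [← pow_mul, pow_two]

lemma ball_bound' (N : ℕ) (μ : Measure (Matrix.unitaryGroup (Fin N) ℂ))
    [IsProbabilityMeasure μ] [μ.IsMulLeftInvariant] :
    ∃ C : ℝ, 0 < C ∧ ∀ t : ℝ, 0 < t →
      μ.real {U | frobSq ((U : Matrix (Fin N) (Fin N) ℂ) - 1) ≤ t} ≤ C * t ^ ((N ^ 2 : ℝ) / 2) := by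
  obtain ⟨K, hK, h⟩ := ball_bound N μ
  refine ⟨(4 * K) ^ (N ^ 2), by positivity, fun t ht => ?_⟩
  have hr : 0 < √t := Real.sqrt_pos.2 ht
  have hp : t ^ ((N ^ 2 : ℝ) / 2) = √t ^ (N ^ 2) := by
    rw [Real.sqrt_eq_rpow, ← Real.rpow_natCast (t ^ (1 / 2 : ℝ)), ← Real.rpow_mul ht.le]
    congr 1; push_cast; ring
  rw [hp, ← mul_pow]
  set r := √t
  have ht2 : t = r ^ 2 := (Real.sq_sqrt ht.le).symm
  rw [ht2]
  by_cases hc : 1 ≤ 2 * (K * r)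
  · refine measureReal_le_one.trans (one_le_pow₀ (by nlinarith))
  push Not at hc
  have hx : 0 < K * r := by positivity
  have hge : 1 ≤ 1 / (2 * (K * r)) := by rw [le_div_iff₀ (by positivity)]; linarith
  set m := ⌊1 / (2 * (K * r))⌋₊
  have hm1 : 1 ≤ m := Nat.one_le_floor_iff _ |>.2 hge
  have hmle : (m : ℝ) ≤ 1 / (2 * (K * r)) := Nat.floor_le (by positivity)
  have hmlt : 1 / (2 * (K * r)) < m + 1 := Nat.lt_floor_add_one _
  have hm1' : (1 : ℝ) ≤ m := by exact_mod_cast hm1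
  rw [le_div_iff₀ (by positivity)] at hmle
  rw [div_lt_iff₀ (by positivity)] at hmlt
  have h1 := h r hr m hm1 (by nlinarith)
  have h2 : 1 ≤ (4 * K * r) * m := by nlinarith
  have h3 : 1 ≤ (4 * K * r) ^ (N ^ 2) * (m : ℝ) ^ (N ^ 2) := by
    rw [← mul_pow]; exact one_le_pow₀ h2
  have hmp : (0 : ℝ) < (m : ℝ) ^ (N ^ 2) := by positivity
  have := h1.trans h3
  rw [mul_comm _ ((m : ℝ) ^ (N ^ 2))] at this
  exact le_of_mul_le_mul_left this hmp

lemma laplace_bound {Ω : Type*} [MeasurableSpace Ω] (μ : Measure Ω) [IsProbabilityMeasure μ]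
    (f : Ω → ℝ) (hf : Measurable f) (hf0 : ∀ x, 0 ≤ f x) (C : ℝ) (hC : 0 < C) (p : ℝ) (hp : 0 ≤ p)
    (h : ∀ t : ℝ, 0 < t → μ.real {x | f x ≤ t} ≤ C * t ^ p) :
    ∃ D : ℝ, 0 < D ∧ ∀ b : ℝ, 0 < b → ∫ x, Real.exp (-b * f x) ∂μ ≤ D * (b⁻¹) ^ p := by
  have hs : Summable fun k : ℕ => Real.exp (-(k : ℝ)) * ((k : ℝ) + 1) ^ p := by
    obtain ⟨n, hn⟩ := exists_nat_ge p
    have h1 := (summable_nat_add_iff 1).2 (Real.summable_pow_mul_exp_neg_nat_mul n (r := 1) one_pos)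
    refine Summable.of_nonneg_of_le (fun k => by positivity) (fun k => ?_) (h1.mul_left (Real.exp 1))
    have h2 : ((k : ℝ) + 1) ^ p ≤ ((k : ℝ) + 1) ^ n := by
      rw [← Real.rpow_natCast]
      exact Real.rpow_le_rpow_of_exponent_le (by linarith [(Nat.cast_nonneg k : (0 : ℝ) ≤ k)]) hn
    have h3 : Real.exp 1 * (((k + 1 : ℕ) : ℝ) ^ n * Real.exp (-1 * ((k + 1 : ℕ) : ℝ)))
        = Real.exp (-(k : ℝ)) * ((k : ℝ) + 1) ^ n := by
      rw [mul_left_comm, ← Real.exp_add, mul_comm]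
      push_cast
      congr 2; ring
    rw [h3]
    gcongr
  set s := ∑' k : ℕ, Real.exp (-(k : ℝ)) * ((k : ℝ) + 1) ^ p with hsdef
  have hs0 : 0 ≤ s := tsum_nonneg fun k => by positivity
  refine ⟨C * (s + 1), by positivity, fun b hb => ?_⟩
  have hbp : 0 ≤ (b⁻¹) ^ p := by positivity
  rw [integral_eq_lintegral_of_nonneg_ae (Filter.Eventually.of_forall fun x => (Real.exp_pos _).le)
    (by fun_prop)]
  refine ENNReal.toReal_le_of_le_ofReal (by positivity) ?_
  let A : ℕ → Set Ω := fun k => {x | f x ≤ ((k : ℝ) + 1) * b⁻¹}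
  have hA : ∀ k, MeasurableSet (A k) := fun k => hf measurableSet_Iic
  calc ∫⁻ x, ENNReal.ofReal (Real.exp (-b * f x)) ∂μ
      ≤ ∫⁻ x, ∑' k : ℕ, (A k).indicator (fun _ => ENNReal.ofReal (Real.exp (-(k : ℝ)))) x ∂μ := by
        refine lintegral_mono fun x => ?_
        have h0 : 0 ≤ b * f x := mul_nonneg hb.le (hf0 x)
        refine le_trans ?_ (ENNReal.le_tsum ⌊b * f x⌋₊)
        have hmem : x ∈ A ⌊b * f x⌋₊ := by
          have := (Nat.lt_floor_add_one (b * f x)).le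
          simp only [A, Set.mem_ofPred_eq]
          rw [← div_eq_mul_inv, le_div_iff₀ hb]; linarith
        rw [Set.indicator_of_mem hmem]
        apply ENNReal.ofReal_le_ofReal
        apply Real.exp_le_exp.2
        have := Nat.floor_le h0
        linarith
    _ = ∑' k : ℕ, ENNReal.ofReal (Real.exp (-(k : ℝ))) * μ (A k) := by
        rw [lintegral_tsum fun k => (measurable_const.indicator (hA k)).aemeasurable]
        congr 1; ext k
        rw [lintegral_indicator_const (hA k)]
    _ ≤ ∑' k : ℕ, ENNReal.ofReal (C * b⁻¹ ^ p * (Real.exp (-(k : ℝ)) * ((k : ℝ) + 1) ^ p)) := by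
        refine ENNReal.tsum_le_tsum fun k => ?_
        have h1 := h (((k : ℝ) + 1) * b⁻¹) (by positivity)
        rw [← ofReal_measureReal (μ := μ) (s := A k), ← ENNReal.ofReal_mul (Real.exp_pos _).le]
        apply ENNReal.ofReal_le_ofReal
        rw [Real.mul_rpow (by positivity) (by positivity)] at h1
        calc _ ≤ Real.exp (-(k : ℝ)) * (C * (((k : ℝ) + 1) ^ p * b⁻¹ ^ p)) := by gcongr
          _ = _ := by ring
    _ = ENNReal.ofReal (C * b⁻¹ ^ p * s) := by
        rw [← ENNReal.ofReal_tsum_of_nonneg (fun k => by positivity) (hs.mul_left _), tsum_mul_left]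
    _ ≤ _ := by
        apply ENNReal.ofReal_le_ofReal
        have : 0 ≤ C * b⁻¹ ^ p := by positivity
        nlinarith

/-- upper bound on the single-bond pure-gauge partition function:
for `μ` the normalized Haar (probability) measure on `U(N)`, there is a constant
`C = C(N) > 0` such that for all `d ∈ {2,3,4}`, `a ∈ (0,1]` and `g² > 0`,
`∫ exp(−(a^{d−4}/g²) ‖1 − U‖²_F) dμ(U) ≤ C (g² a^{4−d})^{N²/2}`. -/
theorem single_bond_partition_upper_bound (N : ℕ) (hN : 1 ≤ N)
    (μ : Measure (Matrix.unitaryGroup (Fin N) ℂ))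
    [IsProbabilityMeasure μ] [μ.IsMulLeftInvariant] :
    ∃ C > (0 : ℝ), ∀ d ∈ ({2, 3, 4} : Set ℕ), ∀ a ∈ Set.Ioc (0 : ℝ) 1, ∀ g2 ∈ Set.Ioi (0 : ℝ),
      (∫ U : Matrix.unitaryGroup (Fin N) ℂ,
          Real.exp (-(a ^ ((d : ℝ) - 4) / g2) *
            frobSq (1 - (U : Matrix (Fin N) (Fin N) ℂ))) ∂μ)
        ≤ C * (g2 * a ^ (4 - (d : ℝ))) ^ ((N ^ 2 : ℝ) / 2) := by
  obtain ⟨C, hC, h⟩ := ball_bound' N μ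
  obtain ⟨D, hD, h2⟩ := laplace_bound μ
    (fun U : Matrix.unitaryGroup (Fin N) ℂ => frobSq ((U : Matrix (Fin N) (Fin N) ℂ) - 1))
    (frobSq_cont 1).measurable (fun U => by rw [frobSq_eq_sum]; positivity) C hC
    ((N ^ 2 : ℝ) / 2) (by positivity) h
  refine ⟨D, hD, fun d _ a ha g2 hg => ?_⟩
  have ha0 : 0 < a := ha.1
  have hg0 : 0 < g2 := hg
  have h3 := h2 (a ^ ((d : ℝ) - 4) / g2) (by positivity)
  have e : (a ^ ((d : ℝ) - 4) / g2)⁻¹ = g2 * a ^ (4 - (d : ℝ)) := by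
    rw [inv_div, div_eq_mul_inv, ← Real.rpow_neg ha0.le, neg_sub]
  rw [e] at h3
  convert h3 using 5 with U
  rw [← frobSq_neg, neg_sub]
end

section
/- Let N ≥ 1 and let μ be the normalized (probability) Haar measure on the group U(N) of N×N complex unitary matrices. Then lim_{β→0⁺} β^{−N²/2} ∫_{U(N)} exp( −‖1 − U‖²_F / β ) dμ(U) = (1/((2π)^N N!)) ∫_{ℝ^N} e^{−|y|²} ∏_{1 ≤ j < k ≤ N} (y_j − y_k)² dy, where ‖·‖_F is the Frobenius norm. Equivalently, with β = (ga)², the continuum limit a → 0⁺ of the normalized pure-gauge free energy per retained bond in spacetime dimension d = 2, f^n_Y = lim_{a→0⁺}[ln z(a) − N² ln(ga)], exists and equals ln of the right-hand side. -/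
open Real MeasureTheory Matrix Filter

noncomputable def hp : ℕ → Polynomial ℝ
  | 0 => 1
  | k+1 => Polynomial.X * hp k - Polynomial.C (1/2) * Polynomial.derivative (hp k)

lemma hp_deg_monic (k : ℕ) : (hp k).natDegree = k ∧ (hp k).Monic := by
  induction k with
  | zero => simp [hp]
  | succ k ih =>
    obtain ⟨h1, h2⟩ := ih
    have hm : (Polynomial.X * hp k).Monic := Polynomial.monic_X.mul h2
    have hd : (Polynomial.X * hp k).natDegree = k + 1 := by
      rw [Polynomial.natDegree_X_mul h2.ne_zero, h1]
    have hlt : (Polynomial.C (1/2 : ℝ) * Polynomial.derivative (hp k)).degree <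
        (Polynomial.X * hp k).degree := by
      rw [Polynomial.degree_eq_natDegree hm.ne_zero, hd]
      rw [Polynomial.degree_C_mul (by norm_num)]
      refine lt_of_le_of_lt (Polynomial.degree_derivative_le) ?_
      rw [Polynomial.degree_eq_natDegree h2.ne_zero, h1]
      exact_mod_cast Nat.lt_succ_self k
    constructor
    · rw [hp, Polynomial.natDegree_sub_eq_left_of_natDegree_lt, hd]
      rw [hd]
      refine lt_of_le_of_lt (Polynomial.natDegree_C_mul_le _ _) ?_
      have := Polynomial.natDegree_derivative_le (hp k)
      omega
    · rw [hp]; exact hm.sub_of_left hlt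

lemma poly_int (p : Polynomial ℝ) : Integrable (fun y : ℝ => p.eval y * Real.exp (-y^2)) := by
  induction p using Polynomial.induction_on' with
  | add p q hp hq => simpa [add_mul] using! hp.add hq
  | monomial n a =>
    have := (integrable_rpow_mul_exp_neg_mul_sq (b := 1) one_pos (s := n)
      (by have : (0:ℝ) ≤ n := n.cast_nonneg
          linarith)).const_mul a
    simpa [mul_assoc] using this

lemma hp_ibp (k : ℕ) (q : Polynomial ℝ) :
    ∫ y : ℝ, (hp (k+1)).eval y * q.eval y * Real.exp (-y^2)
     = (1/2) * ∫ y : ℝ, (hp k).eval y * q.derivative.eval y * Real.exp (-y^2) := by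
  have h := integral_eq_zero_of_hasDerivAt_of_integrable
    (f := fun y : ℝ => (hp k * q).eval y * Real.exp (-y^2))
    (f' := fun y : ℝ => (hp k * q.derivative - Polynomial.C 2 * hp (k+1) * q).eval y * Real.exp (-y^2))
    (fun y => by
      have h1 := (hp k * q).hasDerivAt y
      have h2 : HasDerivAt (fun y : ℝ => Real.exp (-y^2)) (Real.exp (-y^2) * (-(2*y))) y := by
        have := ((hasDerivAt_pow 2 y).neg).exp
        simpa using this
      convert! h1.mul h2 using 1
      simp [hp]; ring) (poly_int _) (poly_int _)
  have i1 := poly_int (hp k * q.derivative)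
  have i2 := poly_int (hp (k+1) * q)
  have : (fun y : ℝ => (hp k * q.derivative - Polynomial.C 2 * hp (k+1) * q).eval y * Real.exp (-y^2))
     = fun y => (hp k * q.derivative).eval y * Real.exp (-y^2)
        - 2 * ((hp (k+1) * q).eval y * Real.exp (-y^2)) := by
    ext y; simp; ring
  rw [this, integral_sub i1 (i2.const_mul 2), integral_const_mul] at h
  simp only [Polynomial.eval_mul] at h
  linarith

lemma hp_iter (k : ℕ) (q : Polynomial ℝ) :
    ∫ y : ℝ, (hp k).eval y * q.eval y * Real.exp (-y^2)
     = (1/2)^k * ∫ y : ℝ, (Polynomial.derivative^[k] q).eval y * Real.exp (-y^2) := by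
  induction k generalizing q with
  | zero => simp [hp]
  | succ k ih => rw [hp_ibp, ih, Function.iterate_succ_apply]; ring

lemma gauss1 : ∫ y : ℝ, Real.exp (-y^2) = √π := by
  simpa using integral_gaussian 1

lemma hp_orth (j k : ℕ) : ∫ y : ℝ, (hp j).eval y * (hp k).eval y * Real.exp (-y^2)
     = if j = k then (1/2)^k * k.factorial * √π else 0 := by
  have key : ∀ j k, k < j → ∫ y : ℝ, (hp j).eval y * (hp k).eval y * Real.exp (-y^2) = 0 := by
    intro j k h
    rw [hp_iter, Polynomial.iterate_derivative_eq_zero (by rw [(hp_deg_monic k).1]; exact h)]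
    simp
  split_ifs with h
  · subst h
    rw [hp_iter]
    have : Polynomial.derivative^[j] (hp j) = Polynomial.C (j.factorial : ℝ) := by
      have hd := (hp_deg_monic j).1
      have hm := (hp_deg_monic j).2
      rw [Polynomial.eq_C_of_natDegree_le_zero (p := Polynomial.derivative^[j] (hp j))]
      · rw [Polynomial.coeff_iterate_derivative]
        have : (hp j).coeff j = 1 := by
          have := hm.coeff_natDegree
          rwa [hd] at this
        simp [this, Nat.descFactorial_self]
      · have := Polynomial.natDegree_iterate_derivative (hp j) j
        omega
    simp only [this, Polynomial.eval_C]
    rw [integral_const_mul, gauss1]; ring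
  · rcases lt_or_gt_of_ne h with h | h
    · rw [← key k j h]; congr 1; ext y; ring
    · exact key j k h

lemma mehta (N : ℕ) : ∫ y : Fin N → ℝ, Real.exp (-(∑ i, y i ^ 2)) *
          ∏ p ∈ Finset.univ.filter (fun p : Fin N × Fin N => p.1 < p.2),
            (y p.1 - y p.2) ^ 2
     = N.factorial * ∏ k : Fin N, ((1/2:ℝ)^(k:ℕ) * (k:ℕ).factorial * √π) := by
  have hdet : ∀ y : Fin N → ℝ, ∏ p ∈ Finset.univ.filter (fun p : Fin N × Fin N => p.1 < p.2),
            (y p.1 - y p.2) ^ 2 = ((Matrix.of (fun i j : Fin N => ((hp j).eval (y i)))).det)^2 := by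
    intro y
    rw [← det_eval_matrixOfPolynomials_eq_det_vandermonde y (fun j => hp j)
      (fun i => (hp_deg_monic i).1) (fun i => (hp_deg_monic i).2), det_vandermonde]
    rw [Finset.prod_filter, Fintype.prod_prod_type, ← Finset.prod_pow]
    refine Finset.prod_congr rfl fun i _ => ?_
    rw [← Finset.prod_pow, ← Finset.prod_filter]
    have : Finset.univ.filter (fun j : Fin N => (i, j).1 < (i, j).2) = Finset.Ioi i := by
      ext j; simp
    rw [this]
    refine Finset.prod_congr rfl fun j _ => ?_
    ring
  have hexp : ∀ y : Fin N → ℝ, Real.exp (-(∑ i, y i ^ 2)) *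
          ∏ p ∈ Finset.univ.filter (fun p : Fin N × Fin N => p.1 < p.2),
            (y p.1 - y p.2) ^ 2 = ∑ σ : Equiv.Perm (Fin N), ∑ τ : Equiv.Perm (Fin N),
       ((Equiv.Perm.sign σ : ℤ) : ℝ) * ((Equiv.Perm.sign τ : ℤ) : ℝ) *
        ∏ i, ((hp (σ i)).eval (y i) * (hp (τ i)).eval (y i) * Real.exp (-(y i)^2)) := by
    intro y
    rw [hdet, ← Matrix.det_transpose, Matrix.det_apply', pow_two, Finset.sum_mul_sum, Finset.mul_sum]
    refine Finset.sum_congr rfl fun σ _ => ?_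
    rw [Finset.mul_sum]
    refine Finset.sum_congr rfl fun τ _ => ?_
    simp only [Finset.prod_mul_distrib, transpose_apply, of_apply]
    rw [← Finset.sum_neg_distrib, Real.exp_sum]
    ring
  simp_rw [hexp]
  have hint : ∀ σ τ : Equiv.Perm (Fin N), Integrable (fun y : Fin N → ℝ =>
       ∏ i, ((hp (σ i)).eval (y i) * (hp (τ i)).eval (y i) * Real.exp (-(y i)^2))) := by
    intro σ τ
    refine Integrable.fintype_prod (f := fun i y => (hp (σ i)).eval y * (hp (τ i)).eval y * Real.exp (-y^2)) fun i => ?_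
    simpa using poly_int (hp (σ i) * hp (τ i))
  rw [integral_finsetSum _ (fun σ _ => integrable_finsetSum _ fun τ _ => (hint σ τ).const_mul _)]
  have : ∀ σ : Equiv.Perm (Fin N), ∫ y : Fin N → ℝ, ∑ τ : Equiv.Perm (Fin N),
       ((Equiv.Perm.sign σ : ℤ) : ℝ) * ((Equiv.Perm.sign τ : ℤ) : ℝ) *
        ∏ i, ((hp (σ i)).eval (y i) * (hp (τ i)).eval (y i) * Real.exp (-(y i)^2))
        = ∏ k : Fin N, ((1/2:ℝ)^(k:ℕ) * (k:ℕ).factorial * √π) := by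
    intro σ
    rw [integral_finsetSum _ (fun τ _ => (hint σ τ).const_mul _)]
    have h1 : ∀ τ : Equiv.Perm (Fin N), ∫ y : Fin N → ℝ, 
       ((Equiv.Perm.sign σ : ℤ) : ℝ) * ((Equiv.Perm.sign τ : ℤ) : ℝ) *
        ∏ i, ((hp (σ i)).eval (y i) * (hp (τ i)).eval (y i) * Real.exp (-(y i)^2))
        = ((Equiv.Perm.sign σ : ℤ) : ℝ) * ((Equiv.Perm.sign τ : ℤ) : ℝ) *
          ∏ i, (if σ i = τ i then (1/2:ℝ)^(τ i:ℕ) * (τ i:ℕ).factorial * √π else 0) := by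
      intro τ
      rw [integral_const_mul, integral_fintype_prod_volume_eq_prod
        (f := fun i y => (hp (σ i)).eval y * (hp (τ i)).eval y * Real.exp (-y^2))]
      congr 1
      refine Finset.prod_congr rfl fun i _ => ?_
      rw [hp_orth]
      simp [Fin.ext_iff]
    simp_rw [h1]
    rw [Finset.sum_eq_single σ]
    · have : ((Equiv.Perm.sign σ : ℤ) : ℝ) * ((Equiv.Perm.sign σ : ℤ) : ℝ) = 1 := by
        rw [← Int.cast_mul, ← Units.val_mul, Int.units_mul_self]; simp
      rw [this, one_mul]
      simp only [if_true]
      exact Equiv.prod_comp σ (fun k : Fin N => (1/2:ℝ)^(k:ℕ) * (k:ℕ).factorial * √π)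
    · intro τ _ h
      have : ∃ i, σ i ≠ τ i := by
        by_contra hc; push Not at hc; exact h (Equiv.ext fun i => (hc i).symm)
      obtain ⟨i, hi⟩ := this
      rw [Finset.prod_eq_zero (Finset.mem_univ i) (by simp [hi]), mul_zero]
    · simp
  simp_rw [this]
  simp [Fintype.card_perm]

open InnerProductSpace (gramSchmidt gramSchmidtNormed)

lemma gs_def {N : ℕ} (f : Fin N → EuclideanSpace ℂ (Fin N)) (n : Fin N) :
   gramSchmidt ℂ f n = f n - ∑ i ∈ Finset.Iio n,
     (inner ℂ (gramSchmidt ℂ f i) (f n) / (inner ℂ (gramSchmidt ℂ f i) (gramSchmidt ℂ f i)))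
        • gramSchmidt ℂ f i := by
  rw [eq_sub_iff_add_eq]
  simp_rw [inner_self_eq_norm_sq_to_K]
  exact (InnerProductSpace.gramSchmidt_def'' ℂ f n).symm

lemma gs_isom {N : ℕ} (L : EuclideanSpace ℂ (Fin N) →ₗ[ℂ] EuclideanSpace ℂ (Fin N))
    (hL : ∀ x y, inner ℂ (L x) (L y) = inner ℂ x y)
    (f : Fin N → EuclideanSpace ℂ (Fin N)) (n : Fin N) :
    gramSchmidt ℂ (fun i => L (f i)) n = L (gramSchmidt ℂ f n) := by
  induction n using WellFoundedLT.induction with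
  | ind n ih =>
    rw [gs_def, gs_def f n, map_sub, map_sum]
    congr 1
    refine Finset.sum_congr rfl fun i hi => ?_
    rw [ih i (Finset.mem_Iio.1 hi), hL, hL, map_smul]

lemma gs_diff {N : ℕ} (f : ℝ → Fin N → EuclideanSpace ℂ (Fin N)) (t : ℝ)
    (hf : ∀ n, DifferentiableAt ℝ (fun s => f s n) t) (hi : LinearIndependent ℂ (f t)) (n : Fin N) :
    DifferentiableAt ℝ (fun s => gramSchmidt ℂ (f s) n) t := by
  induction n using WellFoundedLT.induction with
  | ind n ih =>
    have : (fun s => gramSchmidt ℂ (f s) n) = fun s => f s n - ∑ i ∈ Finset.Iio n,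
     (inner ℂ (gramSchmidt ℂ (f s) i) (f s n) / (inner ℂ (gramSchmidt ℂ (f s) i) (gramSchmidt ℂ (f s) i)))
        • gramSchmidt ℂ (f s) i := by
      ext1 s; exact gs_def _ _
    rw [this]
    refine (hf n).sub (DifferentiableAt.fun_sum fun i hin => ?_)
    have h := ih i (Finset.mem_Iio.1 hin)
    have h0 : inner ℂ (gramSchmidt ℂ (f t) i) (gramSchmidt ℂ (f t) i) ≠ 0 := by
      rw [inner_self_ne_zero]; exact InnerProductSpace.gramSchmidt_ne_zero i hi
    exact (((h.inner ℂ (hf n))).div (h.inner ℂ h) h0).smul h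

lemma gs_meas {N : ℕ} {Ω : Type*} [MeasurableSpace Ω] (f : Ω → Fin N → EuclideanSpace ℂ (Fin N))
    (hf : ∀ n, Measurable (fun s => f s n)) (n : Fin N) :
    Measurable (fun s => gramSchmidt ℂ (f s) n) := by
  induction n using WellFoundedLT.induction with
  | ind n ih =>
    have : (fun s => gramSchmidt ℂ (f s) n) = fun s => f s n - ∑ i ∈ Finset.Iio n,
     (inner ℂ (gramSchmidt ℂ (f s) i) (f s n) / (inner ℂ (gramSchmidt ℂ (f s) i) (gramSchmidt ℂ (f s) i)))
        • gramSchmidt ℂ (f s) i := by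
      ext1 s; exact gs_def _ _
    rw [this]
    refine (hf n).sub (Finset.measurable_fun_sum _ fun i hin => ?_)
    have h := ih i (Finset.mem_Iio.1 hin)
    exact ((h.inner (𝕜 := ℂ) (hf n)).div (h.inner (𝕜 := ℂ) h)).smul h

noncomputable def colv {N : ℕ} (Z : Matrix (Fin N) (Fin N) ℂ) (j : Fin N) : EuclideanSpace ℂ (Fin N) :=
  WithLp.toLp 2 (fun i => Z i j)

noncomputable def Qm {N : ℕ} (Z : Matrix (Fin N) (Fin N) ℂ) : Matrix (Fin N) (Fin N) ℂ :=
  Matrix.of fun i j => gramSchmidtNormed ℂ (colv Z) j i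

lemma colv_indep {N : ℕ} {Z : Matrix (Fin N) (Fin N) ℂ} (hZ : Z.det ≠ 0) :
    LinearIndependent ℂ (colv Z) := by
  have h := (Matrix.linearIndependent_cols_iff_isUnit (A := Z)).2
    ((Matrix.isUnit_iff_isUnit_det Z).2 (isUnit_iff_ne_zero.2 hZ))
  exact h.map' (WithLp.linearEquiv 2 ℂ (Fin N → ℂ)).symm.toLinearMap (LinearEquiv.ker _)

lemma frobSq_eq {N : ℕ} (A : Matrix (Fin N) (Fin N) ℂ) : frobSq A = ∑ j, ∑ i, ‖A i j‖^2 := by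
  simp only [frobSq, Matrix.trace, Matrix.diag, Matrix.mul_apply, Complex.re_sum, conjTranspose_apply]
  refine Finset.sum_congr rfl fun j _ => Finset.sum_congr rfl fun i _ => ?_
  rw [Complex.sq_norm, Complex.normSq_apply]
  simp

lemma frobSq_unit {N : ℕ} (V A : Matrix (Fin N) (Fin N) ℂ) (hV : Vᴴ * V = 1) :
    frobSq (V * A) = frobSq A := by
  simp only [frobSq, conjTranspose_mul]
  rw [Matrix.mul_assoc, ← Matrix.mul_assoc Vᴴ, hV, Matrix.one_mul]

lemma inner_eq {N : ℕ} (x y : EuclideanSpace ℂ (Fin N)) :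
    inner ℂ x y = ∑ i, star (x i) * y i := by
  simp [PiLp.inner_apply, mul_comm]

lemma Qm_equiv {N : ℕ} (V Z : Matrix (Fin N) (Fin N) ℂ) (hV : Vᴴ * V = 1) :
    Qm (V * Z) = V * Qm Z := by
  let L := Matrix.toEuclideanLin V
  have hLa : ∀ x : EuclideanSpace ℂ (Fin N), ∀ i, L x i = ∑ j, V i j * x j := by
    intro x i; simp [L, Matrix.toLpLin_apply, Matrix.mulVec, dotProduct]
  have hL : ∀ x y, inner ℂ (L x) (L y) = inner ℂ x y := by
    intro x y
    rw [EuclideanSpace.inner_eq_star_dotProduct, EuclideanSpace.inner_eq_star_dotProduct]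
    simp only [L, Matrix.toLpLin_apply]
    rw [Matrix.star_mulVec, dotProduct_comm, ← Matrix.dotProduct_mulVec, Matrix.mulVec_mulVec, hV, Matrix.one_mulVec, dotProduct_comm]
  have hc : colv (V * Z) = fun i => L (colv Z i) := by
    ext i j
    rw [hLa]
    simp [colv, Matrix.mul_apply]
  have hn : ∀ x, ‖L x‖ = ‖x‖ := by
    intro x
    rw [norm_eq_sqrt_re_inner (𝕜 := ℂ), norm_eq_sqrt_re_inner (𝕜 := ℂ) x, hL]
  ext i j
  simp only [Qm, of_apply, gramSchmidtNormed, hc, gs_isom L hL, hn]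
  rw [← map_smul, hLa, Matrix.mul_apply]
  rfl

lemma Qm_unit {N : ℕ} {Z : Matrix (Fin N) (Fin N) ℂ} (hZ : Z.det ≠ 0) : (Qm Z)ᴴ * Qm Z = 1 := by
  have h := InnerProductSpace.gramSchmidtNormed_orthonormal (colv_indep hZ)
  rw [orthonormal_iff_ite] at h
  ext i j
  rw [Matrix.mul_apply, Matrix.one_apply, ← h i j, inner_eq]
  rfl

lemma QmZ_apply {N : ℕ} (Z : Matrix (Fin N) (Fin N) ℂ) (i j : Fin N) : ((Qm Z)ᴴ * Z) i j
    = (‖gramSchmidt ℂ (colv Z) i‖ : ℂ)⁻¹ * inner ℂ (gramSchmidt ℂ (colv Z) i) (colv Z j) := by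
  have : ((Qm Z)ᴴ * Z) i j = inner ℂ (gramSchmidtNormed ℂ (colv Z) i) (colv Z j) := by
    rw [inner_eq]; rfl
  rw [this, gramSchmidtNormed, inner_smul_left]
  simp

lemma QmZ_lower {N : ℕ} (Z : Matrix (Fin N) (Fin N) ℂ) (i j : Fin N) (h : j < i) :
    ((Qm Z)ᴴ * Z) i j = 0 := by
  rw [QmZ_apply, InnerProductSpace.gramSchmidt_inv_triangular ℂ _ h, mul_zero]

lemma QmZ_diag {N : ℕ} {Z : Matrix (Fin N) (Fin N) ℂ} (hZ : Z.det ≠ 0) (i : Fin N) :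
    ∃ r : ℝ, 0 < r ∧ ((Qm Z)ᴴ * Z) i i = r := by
  refine ⟨‖gramSchmidt ℂ (colv Z) i‖, norm_pos_iff.2 (InnerProductSpace.gramSchmidt_ne_zero i (colv_indep hZ)), ?_⟩
  have h0 := norm_pos_iff.2 (InnerProductSpace.gramSchmidt_ne_zero i (colv_indep hZ))
  have : inner ℂ (gramSchmidt ℂ (colv Z) i) (colv Z i) = (‖gramSchmidt ℂ (colv Z) i‖ : ℂ)^2 := by
    conv_lhs => rw [InnerProductSpace.gramSchmidt_def'' ℂ (colv Z) i]
    rw [inner_add_right, inner_self_eq_norm_sq_to_K, inner_sum, Finset.sum_eq_zero, add_zero]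
    · rfl
    intro k hk
    rw [inner_smul_right, InnerProductSpace.gramSchmidt_orthogonal ℂ _ (Finset.mem_Iio.1 hk).ne', mul_zero]
  rw [QmZ_apply, this]
  have : (‖gramSchmidt ℂ (colv Z) i‖ : ℂ) ≠ 0 := by exact_mod_cast h0.ne'
  field_simp

lemma Qm_diff {N : ℕ} (Z : ℝ → Matrix (Fin N) (Fin N) ℂ) (t : ℝ)
    (hf : ∀ i j, DifferentiableAt ℝ (fun s => Z s i j) t) (hi : (Z t).det ≠ 0) (i j : Fin N) :
    DifferentiableAt ℝ (fun s => Qm (Z s) i j) t := by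
  have h1 : ∀ n, DifferentiableAt ℝ (fun s => colv (Z s) n) t := by
    intro n
    rw [differentiableAt_piLp]
    exact fun i => hf i n
  have h2 := gs_diff (fun s => colv (Z s)) t h1 (colv_indep hi) j
  have h3 := (h2.norm ℂ (InnerProductSpace.gramSchmidt_ne_zero j (colv_indep hi)))
  have h4 := (differentiableAt_piLp 2).1 h2 i
  have h5 : DifferentiableAt ℝ (fun s => ((‖gramSchmidt ℂ (colv (Z s)) j‖ : ℝ) : ℂ)⁻¹ *
     gramSchmidt ℂ (colv (Z s)) j i) t := by
    refine DifferentiableAt.mul (DifferentiableAt.inv ?_ ?_) h4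
    · exact Complex.ofRealCLM.differentiableAt.comp t h3
    · have := norm_ne_zero_iff.2 (InnerProductSpace.gramSchmidt_ne_zero j (colv_indep hi))
      exact_mod_cast this
  exact h5

lemma Qm_meas {N : ℕ} {Ω : Type*} [MeasurableSpace Ω] (Z : Ω → Matrix (Fin N) (Fin N) ℂ) 
    (hf : ∀ i j, Measurable (fun s => Z s i j)) (i j : Fin N) :
    Measurable (fun s => Qm (Z s) i j) := by
  have h1 : ∀ n, Measurable (fun s => colv (Z s) n) := by
    intro n
    exact (PiLp.continuous_toLp 2 _).measurable.comp (measurable_pi_iff.2 fun i => hf i n)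
  have h2 := gs_meas (fun s => colv (Z s)) h1 j
  have h4 : Measurable (fun s => gramSchmidt ℂ (colv (Z s)) j i) :=
    (measurable_pi_apply i).comp ((PiLp.continuous_ofLp 2 (fun _ : Fin N => ℂ)).measurable.comp h2)
  have h5 : Measurable (fun s => ((‖gramSchmidt ℂ (colv (Z s)) j‖ : ℝ) : ℂ)⁻¹ *
     gramSchmidt ℂ (colv (Z s)) j i) := by
    refine Measurable.mul (Measurable.inv ?_) h4
    exact Complex.measurable_ofReal.comp h2.norm
  exact h5


abbrev KK (N : ℕ) := Fin N × Fin N → ℝ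

noncomputable def Tm {N : ℕ} (τ : KK N) : Matrix (Fin N) (Fin N) ℂ := Matrix.of fun i j =>
  if i < j then (τ (i,j) : ℂ) + Complex.I * τ (j,i) else if i = j then (τ (i,i) : ℂ) else 0

noncomputable def Xm {N : ℕ} (x : KK N) : Matrix (Fin N) (Fin N) ℂ := Matrix.of fun i j =>
  if j < i then (x (i,j) : ℂ) + Complex.I * x (j,i) else if i = j then Complex.I * x (i,i) else 0

noncomputable def Lc {N : ℕ} (M : Matrix (Fin N) (Fin N) ℂ) : KK N := fun p =>
  if p.2 < p.1 then (M p.1 p.2).re else (M p.2 p.1).im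

noncomputable def Uc {N : ℕ} (M : Matrix (Fin N) (Fin N) ℂ) : KK N := fun p =>
  if p.1 ≤ p.2 then (M p.1 p.2).re else (M p.2 p.1).im

lemma Uc_Tm {N : ℕ} (τ : KK N) : Uc (Tm τ) = τ := by
  ext ⟨i, j⟩
  rcases lt_trichotomy i j with h | h | h
  · simp [Uc, Tm, h, h.le, h.not_ge, h.not_gt, h.ne, h.ne']
  · subst h; simp [Uc, Tm]
  · simp [Uc, Tm, h, h.le, h.not_ge, h.not_gt, h.ne, h.ne']

lemma Lc_Tm {N : ℕ} (τ : KK N) : Lc (Tm τ) = 0 := by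
  ext ⟨i, j⟩
  rcases lt_trichotomy i j with h | h | h
  · simp [Lc, Tm, h, h.le, h.not_ge, h.not_gt, h.ne, h.ne']
  · subst h; simp [Lc, Tm]
  · simp [Lc, Tm, h, h.le, h.not_ge, h.not_gt, h.ne, h.ne']

lemma Uc_Xm {N : ℕ} (τ : KK N) : Uc (Xm τ) = 0 := by
  ext ⟨i, j⟩
  rcases lt_trichotomy i j with h | h | h
  · simp [Uc, Xm, h, h.le, h.not_ge, h.not_gt, h.ne, h.ne']
  · subst h; simp [Uc, Xm]
  · simp [Uc, Xm, h, h.le, h.not_ge, h.not_gt, h.ne, h.ne']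

lemma Lc_Xm {N : ℕ} (τ : KK N) : Lc (Xm τ) = τ := by
  ext ⟨i, j⟩
  rcases lt_trichotomy i j with h | h | h
  · simp [Lc, Xm, h, h.le, h.not_ge, h.not_gt, h.ne, h.ne']
  · subst h; simp [Lc, Xm]
  · simp [Lc, Xm, h, h.le, h.not_ge, h.not_gt, h.ne, h.ne']

lemma Tm_Xm {N : ℕ} (M : Matrix (Fin N) (Fin N) ℂ) : Tm (Uc M) + Xm (Lc M) = M := by
  ext i j
  rcases lt_trichotomy i j with h | h | h
  · apply Complex.ext <;> simp [Tm, Uc, Lc, Xm, h, h.le, h.not_ge, h.not_gt, h.ne, h.ne']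
  · subst h; apply Complex.ext <;> simp [Tm, Uc, Lc, Xm]
  · apply Complex.ext <;> simp [Tm, Uc, Lc, Xm, h, h.le, h.not_ge, h.not_gt, h.ne, h.ne']

lemma Lc_add {N : ℕ} (A B : Matrix (Fin N) (Fin N) ℂ) : Lc (A + B) = Lc A + Lc B := by
  ext p; simp only [Lc, Pi.add_apply]; split_ifs <;> simp
lemma Uc_add {N : ℕ} (A B : Matrix (Fin N) (Fin N) ℂ) : Uc (A + B) = Uc A + Uc B := by
  ext p; simp only [Uc, Pi.add_apply]; split_ifs <;> simp
lemma Lc_smul {N : ℕ} (c : ℝ) (A : Matrix (Fin N) (Fin N) ℂ) : Lc (c • A) = c • Lc A := by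
  ext p; simp only [Lc, Pi.smul_apply]; split_ifs <;> simp
lemma Uc_smul {N : ℕ} (c : ℝ) (A : Matrix (Fin N) (Fin N) ℂ) : Uc (c • A) = c • Uc A := by
  ext p; simp only [Uc, Pi.smul_apply]; split_ifs <;> simp
lemma Tm_add {N : ℕ} (a b : KK N) : Tm (a + b) = Tm a + Tm b := by
  ext i j; simp only [Tm, of_apply, Matrix.add_apply]; split_ifs <;> simp; ring
lemma Xm_add {N : ℕ} (a b : KK N) : Xm (a + b) = Xm a + Xm b := by
  ext i j; simp only [Xm, of_apply, Matrix.add_apply]; split_ifs <;> simp <;> ring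
lemma Tm_smul {N : ℕ} (c : ℝ) (b : KK N) : Tm (c • b) = c • Tm b := by
  ext i j; simp only [Tm, of_apply, Matrix.smul_apply]; split_ifs <;> simp; ring
lemma Xm_smul {N : ℕ} (c : ℝ) (b : KK N) : Xm (c • b) = c • Xm b := by
  ext i j; simp only [Xm, of_apply, Matrix.smul_apply]; split_ifs <;> simp <;> ring

lemma frobSq_coord {N : ℕ} (M : Matrix (Fin N) (Fin N) ℂ) :
    frobSq M = ∑ p, Uc M p ^ 2 + ∑ p, Lc M p ^ 2 := by
  rw [← Finset.sum_add_distrib]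
  have : ∀ p : Fin N × Fin N, Uc M p ^ 2 + Lc M p ^ 2 = (M p.1 p.2).re^2 + (M p.2 p.1).im^2 := by
    rintro ⟨i, j⟩
    by_cases h : j < i
    · simp [Uc, Lc, h, h.not_ge]; ring
    · simp [Uc, Lc, h, not_lt.1 h]
  simp_rw [this]
  rw [Finset.sum_add_distrib, frobSq_eq, Fintype.sum_prod_type, Fintype.sum_prod_type]
  rw [Finset.sum_comm (f := fun i j => (M i j).re^2), ← Finset.sum_add_distrib]
  refine Finset.sum_congr rfl fun j _ => ?_
  rw [← Finset.sum_add_distrib]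
  refine Finset.sum_congr rfl fun i _ => ?_
  rw [Complex.sq_norm, Complex.normSq_apply]; ring

noncomputable def Zm {N : ℕ} (p : KK N × KK N) : Matrix (Fin N) (Fin N) ℂ := Tm p.1 + Xm p.2

noncomputable def act {N : ℕ} (V : Matrix (Fin N) (Fin N) ℂ) : (KK N × KK N) →ₗ[ℝ] (KK N × KK N) where
  toFun p := (Uc (V * Zm p), Lc (V * Zm p))
  map_add' p q := by
    simp only [Zm, Prod.fst_add, Prod.snd_add, Tm_add, Xm_add, Matrix.mul_add, Uc_add, Lc_add, Prod.mk_add_mk]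
    ext <;> simp <;> ring
  map_smul' c p := by
    simp only [Zm, Prod.smul_fst, Prod.smul_snd, Tm_smul, Xm_smul, Matrix.mul_add, Uc_add, Lc_add,
      Matrix.mul_smul, Uc_smul, Lc_smul, RingHom.id_apply]
    ext <;> simp <;> ring

lemma Zm_act {N : ℕ} (V : Matrix (Fin N) (Fin N) ℂ) (p : KK N × KK N) : Zm (act V p) = V * Zm p := by
  exact Tm_Xm _

lemma Uc_Zm {N : ℕ} (p : KK N × KK N) : Uc (Zm p) = p.1 := by
  rw [Zm, Uc_add, Uc_Tm, Uc_Xm, add_zero]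
lemma Lc_Zm {N : ℕ} (p : KK N × KK N) : Lc (Zm p) = p.2 := by
  rw [Zm, Lc_add, Lc_Tm, Lc_Xm, zero_add]

lemma frobSq_Zm {N : ℕ} (p : KK N × KK N) : frobSq (Zm p) = ∑ i, p.1 i ^ 2 + ∑ i, p.2 i ^ 2 := by
  rw [frobSq_coord, Uc_Zm, Lc_Zm]

lemma Zm_inj {N : ℕ} {p q : KK N × KK N} (h : Zm p = Zm q) : p = q := by
  ext1
  · rw [← Uc_Zm, ← Uc_Zm, h]
  · rw [← Lc_Zm, ← Lc_Zm, h]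

lemma Tm_meas {N : ℕ} (i j : Fin N) : Continuous (fun τ : KK N => Tm τ i j) := by
  simp only [Tm, of_apply]; split_ifs <;> fun_prop
lemma Xm_meas {N : ℕ} (i j : Fin N) : Continuous (fun τ : KK N => Xm τ i j) := by
  simp only [Xm, of_apply]; split_ifs <;> fun_prop
lemma Zm_cont {N : ℕ} : Continuous (fun p : KK N × KK N => Zm p) := by
  refine continuous_matrix fun i j => ?_
  exact ((Tm_meas i j).comp continuous_fst).add ((Xm_meas i j).comp continuous_snd)

lemma gaussK (N : ℕ) : Integrable (fun x : KK N => Real.exp (-∑ i, x i ^2)) ∧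
    ∫ x : KK N, Real.exp (-∑ i, x i ^2) = √π ^ (N*N) := by
  have : (fun x : KK N => Real.exp (-∑ i, x i ^2)) = fun x => ∏ i, Real.exp (-(x i)^2) := by
    ext x; rw [← Finset.sum_neg_distrib, Real.exp_sum]
  rw [this]
  constructor
  · refine Integrable.fintype_prod (f := fun _ y => Real.exp (-y^2)) fun i => ?_
    simpa using integrable_exp_neg_mul_sq one_pos
  · rw [integral_fintype_prod_volume_eq_pow (f := fun y : ℝ => Real.exp (-y^2))]
    have : ∫ y : ℝ, Real.exp (-y^2) = √π := by simpa using integral_gaussian 1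
    rw [this]; simp

lemma gaussKK (N : ℕ) : Integrable (fun p : KK N × KK N => Real.exp (-frobSq (Zm p))) ∧
    ∫ p : KK N × KK N, Real.exp (-frobSq (Zm p)) = π ^ (N*N) := by
  have : (fun p : KK N × KK N => Real.exp (-frobSq (Zm p))) = fun p =>
      Real.exp (-∑ i, p.1 i ^2) * Real.exp (-∑ i, p.2 i ^2) := by
    ext p; rw [frobSq_Zm, ← Real.exp_add]; congr 1; ring
  rw [this]
  constructor
  · exact (gaussK N).1.mul_prod (gaussK N).1
  · rw [Measure.volume_eq_prod, integral_prod_mul (fun x : KK N => Real.exp (-∑ i, x i ^2))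
      (fun x : KK N => Real.exp (-∑ i, x i ^2)), (gaussK N).2, ← mul_pow, Real.mul_self_sqrt Real.pi_pos.le]

instance haarKK (N : ℕ) : (volume : Measure (KK N × KK N)).IsAddHaarMeasure := by
  rw [Measure.volume_eq_prod]
  apply MeasureTheory.Measure.prod.instIsAddHaarMeasure

lemma act_mp {N : ℕ} (V : Matrix (Fin N) (Fin N) ℂ) (hV : Vᴴ * V = 1) :
    MeasurePreserving (act V) (volume : Measure (KK N × KK N)) volume := by
  have hdet : LinearMap.det (act V) ≠ 0 := by
    have : (act Vᴴ) ∘ₗ (act V) = LinearMap.id := by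
      refine LinearMap.ext fun x => Zm_inj ?_
      simp only [LinearMap.comp_apply, Zm_act, ← Matrix.mul_assoc, hV, Matrix.one_mul, LinearMap.id_apply]
    have h := congrArg LinearMap.det this
    rw [LinearMap.det_comp, LinearMap.det_id] at h
    exact right_ne_zero_of_mul_eq_one h
  have hm : Measurable (act V) := (act V).continuous_of_finiteDimensional.measurable
  have h := Measure.map_linearMap_addHaar_eq_smul_addHaar (volume : Measure (KK N × KK N)) hdet
  refine ⟨hm, ?_⟩
  set c := |(LinearMap.det (act V))⁻¹|
  have hc0 : 0 ≤ c := abs_nonneg _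
  have h1 : ∫ p, Real.exp (-frobSq (Zm p)) ∂(Measure.map (act V) (volume : Measure (KK N × KK N)))
     = π^(N*N) := by
    rw [integral_map hm.aemeasurable]
    · simp_rw [Zm_act, frobSq_unit _ _ hV]
      exact (gaussKK N).2
    · rw [h]
      exact (gaussKK N).1.aestronglyMeasurable.smul_measure _
  rw [h, integral_smul_measure, (gaussKK N).2, ENNReal.toReal_ofReal hc0] at h1
  have hc : c = 1 := by
    have : (π:ℝ)^(N*N) ≠ 0 := by positivity
    simpa [this] using h1
  rw [h, hc]; simp

lemma sing_null (N : ℕ) : volume {p : KK N × KK N | (Zm p).det = 0} = 0 := by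
  let v : KK N × KK N := (fun p => if p.1 = p.2 then 1 else 0, 0)
  have hv : ∀ p (t : ℝ), Zm (p + t • v) = Zm p + (t : ℂ) • 1 := by
    intro p t
    ext i j
    simp only [Zm, Prod.fst_add, Prod.snd_add, Tm_add, Xm_add, Prod.smul_fst, Prod.smul_snd, Tm_smul, Xm_smul, v, smul_zero]
    simp only [Matrix.add_apply, Tm, Xm, of_apply, Matrix.smul_apply, Matrix.one_apply]
    rcases lt_trichotomy i j with h | h | h
    · simp [h, h.ne, h.ne', h.not_gt]
    · subst h; simp; ring
    · simp [h, h.ne, h.ne', h.not_gt]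
  have hfin : ∀ p : KK N × KK N, volume {t : ℝ | (Zm (p + t • v)).det = 0} = 0 := by
    intro p
    apply Set.Finite.measure_zero
    have : {t : ℝ | (Zm (p + t • v)).det = 0} = (fun t : ℝ => (t:ℂ)) ⁻¹' {z | (-(Zm p)).charpoly.IsRoot z} := by
      ext t
      simp only [Set.mem_ofPred_eq, hv, Set.mem_preimage, Polynomial.IsRoot, Matrix.eval_charpoly]
      rw [sub_neg_eq_add, add_comm, Matrix.scalar_apply, ← Matrix.smul_one_eq_diagonal]
    rw [this]
    refine Set.Finite.preimage (Complex.ofReal_injective.injOn) ?_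
    exact Polynomial.finite_setOfPred_isRoot ((-(Zm p)).charpoly_monic.ne_zero)
  have hcont : Continuous (fun q : (KK N × KK N) × ℝ => (Zm (q.1 + q.2 • v)).det) :=
    (Zm_cont.comp (by fun_prop)).matrix_det
  have hmeas : MeasurableSet {q : (KK N × KK N) × ℝ | (Zm (q.1 + q.2 • v)).det = 0} :=
    (isClosed_eq hcont continuous_const).measurableSet
  have h0 : ((volume : Measure (KK N × KK N)).prod (volume : Measure ℝ)) {q : (KK N × KK N) × ℝ | (Zm (q.1 + q.2 • v)).det = 0} = 0 := by
    rw [Measure.measure_prod_null hmeas]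
    exact Filter.Eventually.of_forall hfin
  rw [← Measure.prod_swap, Measure.map_apply measurable_swap hmeas, Measure.measure_prod_null (measurable_swap hmeas)] at h0
  obtain ⟨t, ht⟩ := h0.exists
  have := measure_preimage_add_right (volume : Measure (KK N × KK N)) (t • v) {p | (Zm p).det = 0}
  rw [← this]
  exact ht

open Classical in
noncomputable def FF {N : ℕ} (β : ℝ) (Z : Matrix (Fin N) (Fin N) ℂ) : ℝ :=
  if Z.det ≠ 0 then Real.exp (-frobSq Z) * Real.exp (-frobSq (1 - Qm Z) / β) else 0

lemma frobSq_nonneg {N : ℕ} (A : Matrix (Fin N) (Fin N) ℂ) : 0 ≤ frobSq A := by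
  rw [frobSq_eq]; positivity

lemma frobSq_star {N : ℕ} (A : Matrix (Fin N) (Fin N) ℂ) : frobSq Aᴴ = frobSq A := by
  rw [frobSq, frobSq, conjTranspose_conjTranspose, Matrix.trace_mul_comm]

lemma frobSq_meas {N : ℕ} {Ω : Type*} [MeasurableSpace Ω] (A : Ω → Matrix (Fin N) (Fin N) ℂ)
    (hA : ∀ i j, Measurable (fun s => A s i j)) : Measurable (fun s => frobSq (A s)) := by
  simp_rw [frobSq_eq]
  exact Finset.measurable_fun_sum _ fun j _ => Finset.measurable_fun_sum _ fun i _ => (hA i j).norm.pow_const 2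

lemma det_meas {N : ℕ} {Ω : Type*} [MeasurableSpace Ω] (A : Ω → Matrix (Fin N) (Fin N) ℂ)
    (hA : ∀ i j, Measurable (fun s => A s i j)) : Measurable (fun s => (A s).det) := by
  simp_rw [Matrix.det_apply]
  refine Finset.measurable_fun_sum _ fun j _ => Measurable.const_smul ?_ _
  exact Finset.measurable_fun_prod _ fun i _ => hA _ _

lemma FF_meas {N : ℕ} {Ω : Type*} [MeasurableSpace Ω] (β : ℝ) (A : Ω → Matrix (Fin N) (Fin N) ℂ)
    (hA : ∀ i j, Measurable (fun s => A s i j)) : Measurable (fun s => FF β (A s)) := by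
  refine Measurable.ite ?_ ?_ measurable_const
  · exact (measurableSet_eq_fun (det_meas A hA) measurable_const).compl
  · refine (frobSq_meas A hA).neg.exp.mul (Measurable.exp ?_)
    refine Measurable.div_const (Measurable.neg ?_) β
    refine frobSq_meas _ fun i j => ?_
    exact measurable_const.sub (Qm_meas A hA i j)

lemma FF_nonneg {N : ℕ} (β : ℝ) (Z : Matrix (Fin N) (Fin N) ℂ) : 0 ≤ FF β Z := by
  rw [FF]; split_ifs <;> positivity

lemma FF_le {N : ℕ} (β : ℝ) (hβ : 0 < β) (Z : Matrix (Fin N) (Fin N) ℂ) : FF β Z ≤ Real.exp (-frobSq Z) := by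
  rw [FF]; split_ifs with h
  · refine mul_le_of_le_one_right (Real.exp_pos _).le ?_
    rw [Real.exp_le_one_iff]
    exact div_nonpos_of_nonpos_of_nonneg (neg_nonpos.2 (frobSq_nonneg _)) hβ.le
  · positivity

lemma Zm_meas {N : ℕ} (i j : Fin N) : Measurable (fun p : KK N × KK N => Zm p i j) :=
  ((Tm_meas i j).measurable.comp measurable_fst).add ((Xm_meas i j).measurable.comp measurable_snd)

instance {N : ℕ} : BorelSpace (Matrix.unitaryGroup (Fin N) ℂ) := ⟨rfl⟩

lemma U_meas {N : ℕ} (i j : Fin N) :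
    Measurable (fun V : Matrix.unitaryGroup (Fin N) ℂ => (V : Matrix (Fin N) (Fin N) ℂ) i j) := by
  refine Continuous.measurable ?_
  exact (continuous_apply_apply i j).comp continuous_subtype_val

lemma haar_gauss (N : ℕ) (μ : Measure (Matrix.unitaryGroup (Fin N) ℂ))
    [IsProbabilityMeasure μ] [μ.IsMulLeftInvariant] (β : ℝ) (hβ : 0 < β) :
    ∫ p : KK N × KK N, FF β (Zm p)
     = π^(N*N) * ∫ U : Matrix.unitaryGroup (Fin N) ℂ,
          Real.exp (-frobSq (1 - (U : Matrix (Fin N) (Fin N) ℂ)) / β) ∂μ := by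
  set I := ∫ U : Matrix.unitaryGroup (Fin N) ℂ,
          Real.exp (-frobSq (1 - (U : Matrix (Fin N) (Fin N) ℂ)) / β) ∂μ with hI
  have hu : ∀ V : Matrix.unitaryGroup (Fin N) ℂ, (V : Matrix (Fin N) (Fin N) ℂ)ᴴᴴ * (V : Matrix (Fin N) (Fin N) ℂ)ᴴ = 1 := by
    intro V; rw [conjTranspose_conjTranspose]; exact Matrix.mem_unitaryGroup_iff.1 V.2
  have h1 : ∀ V : Matrix.unitaryGroup (Fin N) ℂ, ∫ p : KK N × KK N, FF β ((V : Matrix (Fin N) (Fin N) ℂ)ᴴ * Zm p)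
      = ∫ p : KK N × KK N, FF β (Zm p) := by
    intro V
    have hmp := act_mp (V : Matrix (Fin N) (Fin N) ℂ)ᴴ (hu V)
    have h := integral_map (μ := volume) (f := fun p => FF β (Zm p)) hmp.measurable.aemeasurable
      (FF_meas β _ Zm_meas).aestronglyMeasurable
    rw [hmp.map_eq] at h
    rw [h]
    simp_rw [Zm_act]
  have h2 : ∫ p : KK N × KK N, FF β (Zm p) =
      ∫ V : Matrix.unitaryGroup (Fin N) ℂ, ∫ p : KK N × KK N, FF β ((V : Matrix (Fin N) (Fin N) ℂ)ᴴ * Zm p) ∂volume ∂μ := by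
    simp_rw [h1]; simp
  have hfr : ∀ (V : Matrix.unitaryGroup (Fin N) ℂ) (Z : Matrix (Fin N) (Fin N) ℂ), frobSq ((V : Matrix (Fin N) (Fin N) ℂ)ᴴ * Z) = frobSq Z :=
    fun V Z => frobSq_unit _ _ (hu V)
  rw [h2, integral_integral_swap]
  · have h3 : ∀ p : KK N × KK N, (Zm p).det ≠ 0 → ∫ V : Matrix.unitaryGroup (Fin N) ℂ, FF β ((V : Matrix (Fin N) (Fin N) ℂ)ᴴ * Zm p) ∂μ
        = Real.exp (-frobSq (Zm p)) * I := by
      intro p hp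
      let W : Matrix.unitaryGroup (Fin N) ℂ := ⟨Qm (Zm p), Matrix.mem_unitaryGroup_iff'.2 (Qm_unit hp)⟩
      have hW : ∀ V : Matrix.unitaryGroup (Fin N) ℂ, ((W⁻¹ * V : Matrix.unitaryGroup (Fin N) ℂ) : Matrix (Fin N) (Fin N) ℂ)
          = (Qm (Zm p))ᴴ * V := fun V => rfl
      clear_value W
      have h4 : ∀ V : Matrix.unitaryGroup (Fin N) ℂ, FF β ((V : Matrix (Fin N) (Fin N) ℂ)ᴴ * Zm p)
         = Real.exp (-frobSq (Zm p)) * Real.exp (-frobSq (1 - ((W⁻¹ * V : Matrix.unitaryGroup (Fin N) ℂ) : Matrix (Fin N) (Fin N) ℂ)) / β) := by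
        intro V
        have hd : ((V : Matrix (Fin N) (Fin N) ℂ)ᴴ * Zm p).det ≠ 0 := by
          rw [Matrix.det_mul]
          refine mul_ne_zero (fun h => ?_) hp
          have := congrArg Matrix.det (hu V)
          rw [Matrix.det_mul, h] at this
          simp at this
        rw [FF, if_pos hd, hfr, Qm_equiv _ _ (hu V)]
        rw [hW V, ← frobSq_star (1 - (V : Matrix (Fin N) (Fin N) ℂ)ᴴ * _), conjTranspose_sub,
          conjTranspose_one, conjTranspose_mul, conjTranspose_conjTranspose]
      simp_rw [h4]
      rw [integral_const_mul, integral_mul_left_eq_self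
        (fun V : Matrix.unitaryGroup (Fin N) ℂ => Real.exp (-frobSq (1 - (V : Matrix (Fin N) (Fin N) ℂ)) / β))]
    rw [← (gaussKK N).2, ← integral_mul_const]
    refine integral_congr_ae ?_
    have h5 : ∀ᵐ p : KK N × KK N, (Zm p).det ≠ 0 := by
      rw [ae_iff]; simpa using sing_null N
    filter_upwards [h5] with p hp using h3 p hp
  · have hdom : Integrable (fun q : Matrix.unitaryGroup (Fin N) ℂ × (KK N × KK N) => Real.exp (-frobSq (Zm q.2)))
       (μ.prod volume) := (gaussKK N).1.comp_snd μ
    refine hdom.mono' ?_ ?_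
    · refine (FF_meas β (fun q : Matrix.unitaryGroup (Fin N) ℂ × (KK N × KK N) => (q.1 : Matrix (Fin N) (Fin N) ℂ)ᴴ * Zm q.2) fun i j => ?_).aestronglyMeasurable
      simp only [Matrix.mul_apply, conjTranspose_apply]
      refine Finset.measurable_fun_sum _ fun k _ => Measurable.mul ?_ ?_
      · exact (continuous_star.measurable).comp ((U_meas k i).comp measurable_fst)
      · exact (Zm_meas k j).comp measurable_snd
    · refine Filter.Eventually.of_forall fun q => ?_
      simp only [Function.uncurry]
      rw [Real.norm_of_nonneg (FF_nonneg _ _)]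
      exact (FF_le β hβ _).trans_eq (by rw [hfr])


noncomputable def Phi {N : ℕ} (τ : KK N) : KK N →ₗ[ℝ] KK N where
  toFun a := Lc (Xm a * Tm τ)
  map_add' a b := by rw [Xm_add, Matrix.add_mul, Lc_add]
  map_smul' c a := by rw [Xm_smul, Matrix.smul_mul, Lc_smul]; rfl

lemma Phi_aux {N : ℕ} (τ a : KK N) (i k : Fin N) (hik : k ≤ i)
    (ha : ∀ s : Fin N × Fin N, min s.1 s.2 < k → a s = 0) :
    (Xm a * Tm τ) i k = Xm a i k * (τ (k,k) : ℂ) := by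
  rw [Matrix.mul_apply, Finset.sum_eq_single k]
  · simp [Tm]
  · intro j _ hj
    rcases lt_or_gt_of_ne hj with h | h
    · have h1 := ha (i,j) (by simp [h])
      have h2 := ha (j,i) (by simp [h])
      have h3 : j < i := h.trans_le hik
      simp [Xm, h3, h1, h2]
    · simp [Tm, h.not_gt, h.ne']
  · simp

lemma Phi_apply {N : ℕ} (τ a : KK N) (r : Fin N × Fin N)
    (ha : ∀ s : Fin N × Fin N, min s.1 s.2 < min r.1 r.2 → a s = 0) :
    Phi τ a r = a r * τ (min r.1 r.2, min r.1 r.2) := by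
  have h0 : Lc (Xm a) r = a r := by rw [Lc_Xm]
  obtain ⟨r1, r2⟩ := r
  change Lc (Xm a * Tm τ) (r1, r2) = _
  by_cases h : r2 < r1
  · simp only [Lc, h, if_true] at h0 ⊢
    rw [Phi_aux τ a r1 r2 h.le (by simpa [h.le] using ha), Complex.re_mul_ofReal, h0]
    simp [h.le]
  · simp only [Lc, h, if_false] at h0 ⊢
    have h' := not_lt.1 h
    rw [Phi_aux τ a r2 r1 h' (by simpa [h'] using ha), Complex.im_mul_ofReal, h0]
    simp [h']

lemma card_min {N : ℕ} (k : Fin N) :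
    Fintype.card {r : Fin N × Fin N // min r.1 r.2 = k} = 2 * (N - 1 - k) + 1 := by
  rw [Fintype.card_subtype]
  have : (Finset.univ.filter fun r : Fin N × Fin N => min r.1 r.2 = k) =
      ({k} ×ˢ Finset.Ici k) ∪ (Finset.Ioi k ×ˢ {k}) := by
    ext ⟨i, j⟩
    simp only [Finset.mem_filter, Finset.mem_univ, true_and, Finset.mem_union, Finset.mem_product,
      Finset.mem_singleton, Finset.mem_Ici, Finset.mem_Ioi]
    rcases le_total i j with h | h
    · rw [min_eq_left h]
      constructor
      · rintro rfl; exact Or.inl ⟨rfl, h⟩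
      · rintro (⟨h1, _⟩ | ⟨h1, h2⟩)
        · exact h1
        · subst h2; exact absurd h1 h.not_gt
    · rw [min_eq_right h]
      constructor
      · rintro rfl
        rcases eq_or_lt_of_le h with h | h
        · exact Or.inl ⟨h.symm, le_rfl⟩
        · exact Or.inr ⟨h, rfl⟩
      · rintro (⟨h1, h2⟩ | ⟨h1, h2⟩)
        · subst h1; exact le_antisymm h h2
        · exact h2
  rw [this, Finset.card_union_of_disjoint]
  · simp only [Finset.card_product, Finset.card_singleton, Fin.card_Ici, Fin.card_Ioi]
    have := k.2
    omega
  · rw [Finset.disjoint_left]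
    rintro ⟨i, j⟩ h1 h2
    simp only [Finset.mem_product, Finset.mem_singleton, Finset.mem_Ici, Finset.mem_Ioi] at h1 h2
    exact absurd h1.1 h2.1.ne'

lemma Phi_det {N : ℕ} (τ : KK N) :
    LinearMap.det (Phi τ) = ∏ k : Fin N, τ (k,k) ^ (2 * (N - 1 - (k:ℕ)) + 1) := by
  rw [← LinearMap.det_toMatrix', ← Matrix.det_transpose]
  have hent : ∀ r s : Fin N × Fin N, min r.1 r.2 ≤ min s.1 s.2 →
      (LinearMap.toMatrix' (Phi τ))ᵀ s r = if r = s then τ (min r.1 r.2, min r.1 r.2) else 0 := by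
    intro r s h
    rw [Matrix.transpose_apply, LinearMap.toMatrix'_apply, Phi_apply]
    · by_cases hrs : r = s
      · subst hrs; simp
      · simp [hrs]
    · intro s' hs'
      have : s' ≠ s := by rintro rfl; exact absurd h hs'.not_ge
      simp [this]
  have hb : (LinearMap.toMatrix' (Phi τ))ᵀ.BlockTriangular (fun r : Fin N × Fin N => min r.1 r.2) := by
    intro s r h
    rw [hent r s h.le, if_neg]
    rintro rfl; exact lt_irrefl _ h
  rw [hb.det_fintype]
  refine Finset.prod_congr rfl fun k _ => ?_
  have : (LinearMap.toMatrix' (Phi τ))ᵀ.toSquareBlock (fun r : Fin N × Fin N => min r.1 r.2) k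
     = Matrix.diagonal (fun _ => τ (k,k)) := by
    ext ⟨s, hs⟩ ⟨r, hr⟩
    rw [Matrix.toSquareBlock_def, Matrix.of_apply, hent r s (by rw [hr, hs]), Matrix.diagonal_apply, hr]
    simp only [Subtype.mk.injEq, eq_comm]
  rw [this, Matrix.det_diagonal, Finset.prod_const, Finset.card_univ, card_min]

lemma Tm_det {N : ℕ} (τ : KK N) : (Tm τ).det = ∏ k, (τ (k,k) : ℂ) := by
  rw [Matrix.det_of_upperTriangular]
  · simp [Tm]
  · intro i j h
    have h' : j < i := h
    simp [Tm, h'.not_gt, h'.ne']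

lemma gs_Tm {N : ℕ} (τ : KK N) (hτ : ∀ k, τ (k,k) ≠ 0) (n : Fin N) :
    gramSchmidt ℂ (colv (Tm τ)) n = (τ (n,n) : ℂ) • EuclideanSpace.single n (1:ℂ) := by
  induction n using WellFoundedLT.induction with
  | ind n ih =>
    rw [gs_def]
    have : ∀ i ∈ Finset.Iio n, (inner ℂ (gramSchmidt ℂ (colv (Tm τ)) i) (colv (Tm τ) n) /
        (inner ℂ (gramSchmidt ℂ (colv (Tm τ)) i) (gramSchmidt ℂ (colv (Tm τ)) i)))
        • gramSchmidt ℂ (colv (Tm τ)) i = (Tm τ i n) • EuclideanSpace.single i (1:ℂ) := by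
      intro i hi
      rw [ih i (Finset.mem_Iio.1 hi)]
      have h0 : (τ (i,i) : ℂ) ≠ 0 := by exact_mod_cast hτ i
      simp only [inner_smul_left, inner_smul_right, EuclideanSpace.inner_single_left, smul_smul]
      congr 1
      simp [colv]
      field_simp
    rw [Finset.sum_congr rfl this]
    ext j
    simp only [colv, PiLp.sub_apply, WithLp.ofLp_sum, Finset.sum_apply, PiLp.smul_apply,
      EuclideanSpace.single_apply, smul_eq_mul, mul_ite, mul_one, mul_zero]
    rw [Finset.sum_ite_eq]
    rcases lt_trichotomy j n with h | h | h
    · simp [h, h.ne]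
    · subst h; simp [Tm]
    · simp [Tm, h.not_gt, h.ne']

lemma Qm_Tm {N : ℕ} (τ : KK N) (hτ : ∀ k, τ (k,k) ≠ 0) (i j : Fin N) :
    Qm (Tm τ) i j = if i = j then ((τ (i,i) / |τ (i,i)| : ℝ) : ℂ) else 0 := by
  simp only [Qm, of_apply, gramSchmidtNormed, gs_Tm τ hτ, norm_smul, PiLp.smul_apply, EuclideanSpace.single_apply]
  split_ifs with h
  · subst h; simp; rw [div_eq_inv_mul]
  · simp

lemma Qm_Tm_pos {N : ℕ} (τ : KK N) (hτ : ∀ k, 0 < τ (k,k)) : Qm (Tm τ) = 1 := by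
  ext i j
  rw [Qm_Tm τ (fun k => (hτ k).ne'), abs_of_pos (hτ i), div_self (hτ i).ne', Matrix.one_apply]
  simp

lemma Lc_TT {N : ℕ} (u τ : KK N) : Lc (Tm u * Tm τ) = 0 := by
  have h1 : ∀ i k : Fin N, k < i → (Tm u * Tm τ) i k = 0 := by
    intro i k h
    rw [Matrix.mul_apply]
    refine Finset.sum_eq_zero fun j _ => ?_
    rcases lt_or_ge j i with h' | h'
    · simp [Tm, h'.not_gt, h'.ne']
    · have : k < j := h.trans_le h'
      simp [Tm, this.not_gt, this.ne']
  have h2 : ∀ i : Fin N, (Tm u * Tm τ) i i = u (i,i) * τ (i,i) := by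
    intro i
    rw [Matrix.mul_apply, Finset.sum_eq_single i]
    · simp [Tm]
    · intro j _ hj
      rcases lt_or_gt_of_ne hj with h' | h'
      · simp [Tm, h'.not_gt, h'.ne']
      · simp [Tm, h'.not_gt, h'.ne']
    · simp
  ext ⟨i, j⟩
  rcases lt_trichotomy i j with h | h | h
  · simp [Lc, h.not_gt, h1 _ _ h]
  · subst h
    simp [Lc, h2]
  · simp [Lc, h, h1 _ _ h]

noncomputable def cq {N : ℕ} (p : Fin N × Fin N) : ℝ := if p.1 = p.2 then 1 else 2

lemma frobSq_skew {N : ℕ} (A : Matrix (Fin N) (Fin N) ℂ) (hA : ∀ i j, star (A j i) + A i j = 0) :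
    frobSq A = ∑ p, cq p * Lc A p ^ 2 := by
  have hre : ∀ i j, (A i j).re = -(A j i).re := fun i j => by
    have := congrArg Complex.re (hA i j); simp at this; linarith
  have him : ∀ i j, (A i j).im = (A j i).im := fun i j => by
    have := congrArg Complex.im (hA i j); simp at this; linarith
  rw [frobSq_coord]
  have : ∀ p : Fin N × Fin N, Uc A p ^ 2 = (cq p.swap - 1) * Lc A p.swap ^ 2 := by
    rintro ⟨i, j⟩
    rcases lt_trichotomy i j with h | h | h
    · simp [Uc, Lc, cq, h, h.le, h.ne']; rw [hre]; norm_num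
    · subst h
      have := hre i i
      have : (A i i).re = 0 := by linarith
      simp [Uc, cq, this]
    · simp [Uc, Lc, cq, h, h.not_ge, h.ne, h.not_gt]; rw [him]; norm_num
  simp_rw [this]
  have hs : ∑ x : Fin N × Fin N, (cq x.swap - 1) * Lc A x.swap ^ 2 = ∑ p, (cq p - 1) * Lc A p ^ 2 :=
    (Equiv.prodComm (Fin N) (Fin N)).sum_comp (fun p => (cq p - 1) * Lc A p ^ 2)
  rw [hs, ← Finset.sum_add_distrib]
  refine Finset.sum_congr rfl fun p _ => by ring

lemma frobSq_mul_le {N : ℕ} (A B : Matrix (Fin N) (Fin N) ℂ) : frobSq (A * B) ≤ frobSq A * frobSq B := by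
  letI := Matrix.frobeniusNormedAddCommGroup (m := Fin N) (n := Fin N) (α := ℂ)
  have h : ∀ M : Matrix (Fin N) (Fin N) ℂ, frobSq M = ‖M‖^2 := by
    intro M
    rw [Matrix.frobenius_norm_def, ← Real.sqrt_eq_rpow, Real.sq_sqrt (by positivity), frobSq_eq, Finset.sum_comm]
    simp
  rw [h, h, h, ← mul_pow]
  exact pow_le_pow_left₀ (norm_nonneg _) (Matrix.frobenius_norm_mul A B) 2

lemma Lc_bound {N : ℕ} {Z : Matrix (Fin N) (Fin N) ℂ} (hZ : Z.det ≠ 0) :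
    ∑ p, Lc Z p ^ 2 ≤ frobSq (1 - Qm Z) * frobSq Z := by
  set T := (Qm Z)ᴴ * Z with hT
  have hQ := Qm_unit hZ
  have hQ' : Qm Z * (Qm Z)ᴴ = 1 := mul_eq_one_comm.1 hQ
  have hZT : Z = Qm Z * T := by rw [hT, ← Matrix.mul_assoc, hQ', Matrix.one_mul]
  have hLT : Lc T = 0 := by
    ext ⟨i, j⟩
    rcases lt_trichotomy i j with h | h | h
    · simp [Lc, h.not_gt, hT, QmZ_lower Z _ _ h]
    · subst h
      obtain ⟨r, _, hr⟩ := QmZ_diag hZ i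
      simp [Lc, hT, hr]
    · simp [Lc, h, hT, QmZ_lower Z _ _ h]
  have hLZ : Lc Z = - Lc ((1 - Qm Z) * T) := by
    have h1 : T = Z + (1 - Qm Z) * T := by rw [Matrix.sub_mul, ← hZT, Matrix.one_mul]; abel
    have h2 := congrArg Lc h1
    rw [Lc_add, hLT] at h2
    exact eq_neg_of_add_eq_zero_left h2.symm
  have hfT : frobSq T = frobSq Z := frobSq_unit _ _ (by rw [conjTranspose_conjTranspose, hQ'])
  calc ∑ p, Lc Z p ^ 2 = ∑ p, Lc ((1 - Qm Z) * T) p ^ 2 := by rw [hLZ]; simp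
    _ ≤ frobSq ((1 - Qm Z) * T) := by
        rw [frobSq_coord]; exact le_add_of_nonneg_left (Finset.sum_nonneg fun _ _ => sq_nonneg _)
    _ ≤ _ := by rw [← hfT]; exact frobSq_mul_le _ _


lemma Lc_QZ {N : ℕ} {Z : Matrix (Fin N) (Fin N) ℂ} (hZ : Z.det ≠ 0) : Lc ((Qm Z)ᴴ * Z) = 0 := by
  ext ⟨i, j⟩
  rcases lt_trichotomy i j with h | h | h
  · simp [Lc, h.not_gt, QmZ_lower Z _ _ h]
  · subst h
    obtain ⟨r, _, hr⟩ := QmZ_diag hZ i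
    simp [Lc, hr]
  · simp [Lc, h, QmZ_lower Z _ _ h]

lemma Lc_deriv {N : ℕ} (M : ℝ → Matrix (Fin N) (Fin N) ℂ) (M' : Matrix (Fin N) (Fin N) ℂ) (t : ℝ)
    (h : ∀ i j, HasDerivAt (fun s => M s i j) (M' i j) t) (p : Fin N × Fin N) :
    HasDerivAt (fun s => Lc (M s) p) (Lc M' p) t := by
  simp only [Lc]
  split_ifs
  · exact Complex.reCLM.hasFDerivAt.comp_hasDerivAt t (h _ _)
  · exact Complex.imCLM.hasFDerivAt.comp_hasDerivAt t (h _ _)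

lemma mul_deriv {N : ℕ} (M L : ℝ → Matrix (Fin N) (Fin N) ℂ) (M' L' : Matrix (Fin N) (Fin N) ℂ) (t : ℝ)
    (h : ∀ i j, HasDerivAt (fun s => M s i j) (M' i j) t)
    (hl : ∀ i j, HasDerivAt (fun s => L s i j) (L' i j) t) (i j : Fin N) :
    HasDerivAt (fun s => (M s * L s) i j) ((M' * L t + M t * L') i j) t := by
  simp only [Matrix.add_apply, Matrix.mul_apply, ← Finset.sum_add_distrib]
  exact HasDerivAt.fun_sum fun k _ => (h i k).mul (hl k j)

lemma curve_entry {N : ℕ} (τ x : KK N) (t : ℝ) (i j : Fin N) :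
    HasDerivAt (fun s => Zm (τ, s • x) i j) (Xm x i j) t := by
  simp only [Zm, Xm_smul, Matrix.add_apply, Matrix.smul_apply]
  have := ((hasDerivAt_id t).smul_const (Xm x i j)).const_add (Tm τ i j)
  simpa using this

lemma curve_zero {N : ℕ} (τ x : KK N) : Zm (τ, (0:ℝ) • x) = Tm τ := by
  rw [Zm, Xm_smul]; simp

lemma Tm_det_ne {N : ℕ} (τ : KK N) (hτ : ∀ k, τ (k,k) ≠ 0) : (Tm τ).det ≠ 0 := by
  rw [Tm_det]; exact Finset.prod_ne_zero_iff.2 fun k _ => by exact_mod_cast hτ k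

lemma curve_det {N : ℕ} (τ x : KK N) (hτ : ∀ k, τ (k,k) ≠ 0) :
    ∀ᶠ s : ℝ in nhds 0, (Zm (τ, s • x)).det ≠ 0 := by
  have hc : Continuous (fun s : ℝ => (Zm (τ, s • x)).det) := by
    refine Continuous.matrix_det ?_
    exact Zm_cont.comp (by fun_prop)
  have := hc.continuousAt (x := 0)
  refine this.eventually_ne ?_
  rw [curve_zero]; exact Tm_det_ne τ hτ

lemma Qcurve_diff {N : ℕ} (τ x : KK N) (hτ : ∀ k, τ (k,k) ≠ 0) (i j : Fin N) :
    DifferentiableAt ℝ (fun s : ℝ => Qm (Zm (τ, s • x)) i j) 0 :=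
  Qm_diff (fun s => Zm (τ, s • x)) 0 (fun i j => (curve_entry τ x 0 i j).differentiableAt)
    (by rw [curve_zero]; exact Tm_det_ne τ hτ) i j

lemma curve_lim {N : ℕ} (τ a : KK N) (hτ : ∀ k, 0 < τ (k,k)) :
    Tendsto (fun s : ℝ => frobSq (1 - Qm (Zm (τ, s • Phi τ a))) / s^2) (nhdsWithin 0 {0}ᶜ)
      (nhds (∑ p, cq p * a p ^ 2)) := by
  have hne : ∀ k, τ (k,k) ≠ 0 := fun k => (hτ k).ne'
  set x := Phi τ a with hx
  let A : Matrix (Fin N) (Fin N) ℂ := Matrix.of fun i j => deriv (fun s : ℝ => Qm (Zm (τ, s • x)) i j) 0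
  have hQ : ∀ i j, HasDerivAt (fun s : ℝ => Qm (Zm (τ, s • x)) i j) (A i j) 0 :=
    fun i j => (Qcurve_diff τ x hne i j).hasDerivAt
  have hQs : ∀ i j, HasDerivAt (fun s : ℝ => (Qm (Zm (τ, s • x)))ᴴ i j) (Aᴴ i j) 0 :=
    fun i j => (hQ j i).star
  have hQ0 : Qm (Zm (τ, (0:ℝ) • x)) = 1 := by rw [curve_zero, Qm_Tm_pos τ hτ]
  have hd := curve_det τ x hne
  have hsk : Aᴴ + A = 0 := by
    ext i j
    have h1 := mul_deriv _ _ _ _ _ hQs hQ i j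
    have h2 : (fun s : ℝ => ((Qm (Zm (τ, s • x)))ᴴ * Qm (Zm (τ, s • x))) i j) =ᶠ[nhds 0]
        fun _ => (1 : Matrix (Fin N) (Fin N) ℂ) i j := by
      filter_upwards [hd] with s hs
      rw [Qm_unit hs]
    have h3 := (h1.congr_of_eventuallyEq h2.symm).unique (hasDerivAt_const _ _)
    rw [hQ0] at h3
    simpa using h3
  have hL : Lc (Aᴴ * Tm τ + Xm x) = 0 := by
    ext p
    have h1 := Lc_deriv _ _ _ (mul_deriv _ _ _ _ _ hQs (curve_entry τ x 0)) p
    have h2 : (fun s : ℝ => Lc ((Qm (Zm (τ, s • x)))ᴴ * Zm (τ, s • x)) p) =ᶠ[nhds 0] fun _ => 0 := by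
      filter_upwards [hd] with s hs
      rw [Lc_QZ hs]; rfl
    have h3 := (h1.congr_of_eventuallyEq h2.symm).unique (hasDerivAt_const _ _)
    rw [hQ0, curve_zero, conjTranspose_one, Matrix.one_mul] at h3
    exact h3
  have hLA : Phi τ (Lc A) = Phi τ a := by
    have h1 : Aᴴ = -A := eq_neg_of_add_eq_zero_left hsk
    rw [h1, Lc_add, Lc_Xm, hx] at hL
    have h2 : (-A) * Tm τ = (-1:ℝ) • (A * Tm τ) := by simp
    have h3 : A * Tm τ = Tm (Uc A) * Tm τ + Xm (Lc A) * Tm τ := by rw [← Matrix.add_mul, Tm_Xm]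
    rw [h2, Lc_smul, h3, Lc_add, Lc_TT, zero_add] at hL
    change (-1:ℝ) • Phi τ (Lc A) + Phi τ a = 0 at hL
    rw [neg_one_smul] at hL
    exact (neg_add_eq_zero.1 hL)
  have hinj : Function.Injective (Phi τ) := by
    have : LinearMap.det (Phi τ) ≠ 0 := by
      rw [Phi_det]; exact Finset.prod_ne_zero_iff.2 fun k _ => pow_ne_zero _ (hne k)
    exact (LinearMap.equivOfDetNeZero (Phi τ) this).injective
  have hAa := hinj hLA
  have hfA : frobSq A = ∑ p, cq p * a p ^ 2 := by
    rw [frobSq_skew A, hAa]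
    intro i j
    have := congrFun (congrFun hsk i) j
    simpa using this
  rw [← hfA, frobSq_eq]
  have hs : ∀ i j, Tendsto (fun s : ℝ => ‖s⁻¹ • (Qm (Zm (τ, s • x)) i j - (1 : Matrix (Fin N) (Fin N) ℂ) i j)‖^2)
      (nhdsWithin 0 {0}ᶜ) (nhds (‖A i j‖^2)) := by
    intro i j
    have := (hasDerivAt_iff_tendsto_slope_zero.1 (hQ i j)).norm.pow 2
    simp only [zero_add, hQ0] at this
    exact this
  have := tendsto_finsetSum Finset.univ fun j _ => tendsto_finsetSum Finset.univ fun i _ => hs i j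
  refine this.congr fun s => ?_
  rw [frobSq_eq]
  simp only [norm_smul, mul_pow, ← Finset.mul_sum, Matrix.sub_apply]
  rw [div_eq_inv_mul]
  congr 1
  · simp
  · simp_rw [norm_sub_rev]

open Classical in
lemma FF_lim_pos {N : ℕ} (τ a : KK N) (hτ : ∀ k, 0 < τ (k,k)) :
    Tendsto (fun s : ℝ => FF (s^2) (Zm (τ, s • Phi τ a))) (nhdsWithin 0 (Set.Ioi 0))
      (nhds (Real.exp (-∑ i, τ i ^2) * Real.exp (-∑ p, cq p * a p ^ 2))) := by
  have hne : ∀ k, τ (k,k) ≠ 0 := fun k => (hτ k).ne'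
  have h1 := (curve_lim τ a hτ).mono_left (nhdsWithin_mono 0 (s := Set.Ioi (0:ℝ)) (fun x hx => (ne_of_gt hx)))
  have h2 : Tendsto (fun s : ℝ => frobSq (Zm (τ, s • Phi τ a))) (nhdsWithin 0 (Set.Ioi 0)) (nhds (∑ i, τ i ^2)) := by
    simp only [frobSq_Zm]
    have hc : Continuous (fun s : ℝ => ∑ i, τ i ^2 + ∑ i, (s • Phi τ a) i ^2) := by
      simp only [Pi.smul_apply]; fun_prop
    have := hc.tendsto 0
    simp only [zero_smul, Pi.zero_apply] at this
    norm_num at this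
    exact this.mono_left nhdsWithin_le_nhds
  refine (h2.neg.rexp.mul h1.neg.rexp).congr' ?_
  filter_upwards [nhdsWithin_le_nhds (curve_det τ (Phi τ a) hne)] with s hs
  rw [FF, if_pos hs, neg_div]

open Classical in
lemma FF_lim_neg {N : ℕ} (τ x : KK N) (hτ : ∀ k, τ (k,k) ≠ 0) (hn : ¬ ∀ k, 0 < τ (k,k)) :
    Tendsto (fun s : ℝ => FF (s^2) (Zm (τ, s • x))) (nhdsWithin 0 (Set.Ioi 0)) (nhds 0) := by
  push Not at hn
  obtain ⟨k, hk⟩ := hn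
  have hk' : τ (k,k) < 0 := lt_of_le_of_ne hk (hτ k)
  have h1 : Tendsto (fun s : ℝ => ‖(1 : Matrix (Fin N) (Fin N) ℂ) k k - Qm (Zm (τ, s • x)) k k‖^2) (nhdsWithin 0 (Set.Ioi 0)) (nhds 4) := by
    have := ((Qcurve_diff τ x hτ k k).continuousAt.tendsto.const_sub (1:ℂ)).norm.pow 2
    rw [curve_zero, Qm_Tm τ hτ, if_pos rfl, abs_of_neg hk', div_neg, div_self hk'.ne] at this
    have h4 : ‖(1:ℂ) - ((-1:ℝ):ℂ)‖^2 = 4 := by norm_num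
    rw [h4] at this
    simpa using this.mono_left nhdsWithin_le_nhds
  have h2 : Tendsto (fun s : ℝ => Real.exp (-(1 / s^2))) (nhdsWithin 0 (Set.Ioi 0)) (nhds 0) := by
    refine Real.tendsto_exp_atBot.comp (tendsto_neg_atTop_atBot.comp ?_)
    have : Tendsto (fun s : ℝ => s⁻¹ ^ 2) (nhdsWithin 0 (Set.Ioi 0)) atTop :=
      (tendsto_pow_atTop two_ne_zero).comp tendsto_inv_nhdsGT_zero
    simpa using this
  refine squeeze_zero' (Eventually.of_forall fun s => FF_nonneg _ _) ?_ h2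
  filter_upwards [h1.eventually (lt_mem_nhds (show (1:ℝ) < 4 by norm_num)), self_mem_nhdsWithin] with s hs hs0
  have hs0 : 0 < s := hs0
  rw [FF]
  split_ifs
  · calc _ ≤ 1 * Real.exp (-(1 / s^2)) := by
          refine mul_le_mul ?_ ?_ (Real.exp_pos _).le zero_le_one
          · rw [Real.exp_le_one_iff, neg_nonpos]; exact frobSq_nonneg _
          · rw [Real.exp_le_exp, neg_div, neg_le_neg_iff]
            gcongr
            rw [frobSq_eq]
            refine hs.le.trans ?_
            have e1 : ∀ j, 0 ≤ ∑ i, ‖(1 - Qm (Zm (τ, s • x))) i j‖^2 := fun j => Finset.sum_nonneg fun _ _ => by positivity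
            refine le_trans ?_ (Finset.single_le_sum (fun j _ => e1 j) (Finset.mem_univ k))
            exact Finset.single_le_sum (f := fun i => ‖(1 - Qm (Zm (τ, s • x))) i k‖^2) (fun i _ => by positivity) (Finset.mem_univ k)
    _ = _ := one_mul _
  · positivity

open Classical in
lemma FF_dom {N : ℕ} (τ x : KK N) (s : ℝ) (hs : 0 < s) :
    FF (s^2) (Zm (τ, s • x)) ≤ Real.exp (-(∑ i, τ i ^2)/2) * Real.exp (-√(∑ i, x i ^2)) := by
  rw [FF]
  split_ifs with h
  · rw [← Real.exp_add, ← Real.exp_add, Real.exp_le_exp]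
    have h1 := Lc_bound h
    rw [Lc_Zm] at h1
    simp only [Pi.smul_apply, smul_eq_mul, mul_pow, ← Finset.mul_sum] at h1
    set d := frobSq (1 - Qm (Zm (τ, s • x)))
    have hd : 0 ≤ d := frobSq_nonneg _
    have hu : ∑ i, τ i ^2 ≤ frobSq (Zm (τ, s • x)) := by
      rw [frobSq_Zm]; exact le_add_of_nonneg_right (Finset.sum_nonneg fun _ _ => sq_nonneg _)
    set u := frobSq (Zm (τ, s • x))
    have hu0 : 0 ≤ u := frobSq_nonneg _
    have hs2 : 0 < s^2 := by positivity
    have hw : ∑ i, x i ^2 ≤ (d / s^2) * u := by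
      rw [div_mul_eq_mul_div, le_div_iff₀ hs2]; linarith
    set w := d / s^2 with hwdef
    have hw0 : 0 ≤ w := by positivity
    have : √(∑ i, x i ^2) ≤ u/2 + w := by
      refine Real.sqrt_le_iff.2 ⟨by positivity, ?_⟩
      nlinarith [sq_nonneg (u/2 - w), mul_nonneg hw0 hu0]
    have e1 : -d / s^2 = -w := by rw [hwdef, neg_div]
    rw [e1]
    linarith
  · positivity


lemma int_abs (c : ℝ) (hc : 0 < c) : Integrable (fun y : ℝ => Real.exp (-(c * |y|))) := by
  rw [← integrableOn_univ, ← Set.Iic_union_Ioi (a := (0:ℝ))]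
  refine IntegrableOn.union ?_ ?_
  · refine (integrableOn_exp_mul_Iic hc 0).congr_fun (fun y hy => ?_) measurableSet_Iic
    have hy : y ≤ 0 := hy
    simp only [abs_of_nonpos hy]; congr 1; ring
  · refine (exp_neg_integrableOn_Ioi 0 hc).congr_fun (fun y hy => ?_) measurableSet_Ioi
    have hy : 0 < y := hy
    simp only [abs_of_pos hy]; congr 1; ring

lemma exp_sqrt_int (N : ℕ) (hN : 1 ≤ N) : Integrable (fun x : KK N => Real.exp (-√(∑ i, x i ^2))) := by
  have hc : (0:ℝ) < 1 / (N*N : ℕ) := by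
    have : 0 < N * N := by positivity
    positivity
  have h := Integrable.fintype_prod (ι := Fin N × Fin N) (μ := fun _ => (volume : Measure ℝ))
    (f := fun _ y => Real.exp (-(1 / (N*N : ℕ) * |y|))) fun i => int_abs _ hc
  refine Integrable.mono' h ?_ ?_
  · refine Continuous.aestronglyMeasurable ?_
    unfold KK; fun_prop
  · refine Eventually.of_forall fun x => ?_
    rw [Real.norm_eq_abs, abs_of_pos (Real.exp_pos _), ← Real.exp_sum, Real.exp_le_exp,
      Finset.sum_neg_distrib, neg_le_neg_iff, ← Finset.mul_sum, one_div, inv_mul_le_iff₀ (by simpa using hc)]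
    have : ∀ i ∈ Finset.univ, |x i| ≤ √(∑ i, x i ^2) := by
      intro i _
      rw [← Real.sqrt_sq_eq_abs]
      exact Real.sqrt_le_sqrt (Finset.single_le_sum (f := fun i => x i ^2) (fun _ _ => sq_nonneg _) (Finset.mem_univ i))
    have := Finset.sum_le_card_nsmul _ _ _ this
    simpa using this

lemma G_int (N : ℕ) : Integrable (fun τ : KK N => Real.exp (-(∑ i, τ i ^2)/2)) := by
  have : (fun x : KK N => Real.exp (-(∑ i, x i ^2)/2)) = fun x => ∏ i, Real.exp (-(1/2) * (x i)^2) := by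
    ext x; rw [← Real.exp_sum, ← Finset.mul_sum]; congr 1; ring
  rw [this]
  exact Integrable.fintype_prod (f := fun _ y => Real.exp (-(1/2) * y^2)) fun i => integrable_exp_neg_mul_sq (by norm_num)

lemma FFs_meas {N : ℕ} (s : ℝ) : Measurable (fun p : KK N × KK N => FF (s^2) (Zm (p.1, s • p.2))) := by
  refine FF_meas _ _ fun i j => ?_
  exact (Zm_meas i j).comp (measurable_fst.prodMk (measurable_snd.const_smul s))

noncomputable def CC (N : ℕ) : ℝ := ∫ a : KK N, Real.exp (-∑ p, cq p * a p ^2)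

lemma Phi_int {N : ℕ} (τ : KK N) (hτ : ∀ k, 0 < τ (k,k)) (F : KK N → ℝ) (hF : Measurable F)  :
    ∫ x, F x = (∏ k, τ (k,k)^(2*(N-1-k)+1)) * ∫ a, F (Phi τ a) := by
  have hp : 0 < LinearMap.det (Phi τ) := by
      rw [Phi_det]; exact Finset.prod_pos fun k _ => pow_pos (hτ k) _
  have h := Measure.map_linearMap_addHaar_eq_smul_addHaar (volume : Measure (Fin N × Fin N → ℝ)) (f := Phi τ) hp.ne'
  have hm : Measurable (Phi τ) := (LinearMap.continuous_of_finiteDimensional (E := Fin N × Fin N → ℝ) (Phi τ)).measurable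
  have := integral_map (μ := (volume : Measure (Fin N × Fin N → ℝ))) hm.aemeasurable (f := F) hF.aestronglyMeasurable
  rw [h, integral_smul_measure, ENNReal.toReal_ofReal (abs_nonneg _), abs_of_pos (inv_pos.2 hp)] at this
  rw [← Phi_det]
  change _ = _ * ∫ a : Fin N × Fin N → ℝ, F (Phi τ a)
  rw [← this, smul_eq_mul, mul_inv_cancel_left₀ hp.ne']

open Classical in
noncomputable def HH {N : ℕ} (τ : KK N) : ℝ :=
  if ∀ k, 0 < τ (k,k) then Real.exp (-∑ i, τ i ^2) * ((∏ k, τ (k,k)^(2*(N-1-k)+1)) * CC N) else 0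

lemma inner_lim {N : ℕ} (hN : 1 ≤ N) (τ : KK N) (hτ : ∀ k, τ (k,k) ≠ 0) :
    Tendsto (fun s : ℝ => ∫ x : KK N, FF (s^2) (Zm (τ, s • x))) (nhdsWithin 0 (Set.Ioi 0)) (nhds (HH τ)) := by
  have hdct : ∀ f : KK N → ℝ, (∀ x, Tendsto (fun s : ℝ => FF (s^2) (Zm (τ, s • x))) (nhdsWithin 0 (Set.Ioi 0)) (nhds (f x)))
      → Tendsto (fun s : ℝ => ∫ x : KK N, FF (s^2) (Zm (τ, s • x))) (nhdsWithin 0 (Set.Ioi 0)) (nhds (∫ x, f x)) := by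
    intro f hf
    refine tendsto_integral_filter_of_dominated_convergence
      (fun x => Real.exp (-(∑ i, τ i ^2)/2) * Real.exp (-√(∑ i, x i ^2))) ?_ ?_ ((exp_sqrt_int N hN).const_mul _)
      (Eventually.of_forall hf)
    · exact Eventually.of_forall fun s => ((FFs_meas s).comp measurable_prodMk_left).aestronglyMeasurable
    · filter_upwards [self_mem_nhdsWithin] with s hs
      refine Eventually.of_forall fun x => ?_
      rw [Real.norm_eq_abs, abs_of_nonneg (FF_nonneg _ _)]
      exact FF_dom τ x s hs
  by_cases hp : ∀ k, 0 < τ (k,k)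
  · have hp' : LinearMap.det (Phi τ) ≠ 0 := by
      rw [Phi_det]; exact Finset.prod_ne_zero_iff.2 fun k _ => pow_ne_zero _ (hτ k)
    let e := LinearMap.equivOfDetNeZero (Phi τ) hp'
    have he : ∀ a, e a = Phi τ a := fun a => rfl
    have h1 := hdct (fun x => Real.exp (-∑ i, τ i ^2) * Real.exp (-∑ p, cq p * e.symm x p ^ 2)) (fun x => by
      have := FF_lim_pos τ (e.symm x) hp
      rwa [← he, LinearEquiv.apply_symm_apply] at this)
    have hm : Measurable (fun x => e.symm x) :=
      (LinearMap.continuous_of_finiteDimensional (E := Fin N × Fin N → ℝ) (e.symm : KK N →ₗ[ℝ] KK N)).measurable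
    have hm2 : Measurable (fun x => Real.exp (-∑ p, cq p * e.symm x p ^ 2)) := by
      refine (Finset.measurable_fun_sum _ fun p _ => ?_).neg.exp
      exact (((measurable_pi_apply p).comp hm).pow_const 2).const_mul _
    rw [integral_const_mul, Phi_int τ hp _ hm2] at h1
    simp only [← he, LinearEquiv.symm_apply_apply] at h1
    rw [HH, if_pos hp]
    exact h1
  · rw [HH, if_neg hp]
    simpa using hdct (fun _ => 0) (fun x => FF_lim_neg τ x hτ hp)

lemma ae_diag (N : ℕ) : ∀ᵐ τ : KK N, ∀ k, τ (k,k) ≠ 0 := by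
  rw [ae_all_iff]
  intro k
  rw [ae_iff]
  simp only [not_not]
  exact Measure.pi_hyperplane (fun _ : Fin N × Fin N => (volume : Measure ℝ)) (k,k) 0

lemma outer_lim {N : ℕ} (hN : 1 ≤ N) :
    Tendsto (fun s : ℝ => ∫ τ : KK N, ∫ x : KK N, FF (s^2) (Zm (τ, s • x))) (nhdsWithin 0 (Set.Ioi 0))
      (nhds (∫ τ : KK N, HH τ)) := by
  refine tendsto_integral_filter_of_dominated_convergence
      (fun τ => Real.exp (-(∑ i, τ i ^2)/2) * ∫ x : KK N, Real.exp (-√(∑ i, x i ^2))) ?_ ?_ ((G_int N).mul_const _) ?_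
  · exact Eventually.of_forall fun s => (FFs_meas s).stronglyMeasurable.integral_prod_right'.aestronglyMeasurable
  · filter_upwards [self_mem_nhdsWithin] with s hs
    refine Eventually.of_forall fun τ => ?_
    rw [Real.norm_eq_abs, abs_of_nonneg (integral_nonneg fun x => FF_nonneg _ _), ← integral_const_mul]
    exact integral_mono_of_nonneg (Eventually.of_forall fun x => FF_nonneg _ _) ((exp_sqrt_int N hN).const_mul _)
      (Eventually.of_forall fun x => FF_dom τ x s hs)
  · filter_upwards [ae_diag N] with τ hτ
    exact inner_lim hN τ hτ

lemma J_scale {N : ℕ} (s : ℝ) (hs : 0 < s) :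
    ∫ τ : KK N, ∫ x : KK N, FF (s^2) (Zm (τ, s • x)) = (s^(N*N))⁻¹ * ∫ p : KK N × KK N, FF (s^2) (Zm p) := by
  have hi : Integrable (fun p : KK N × KK N => FF (s^2) (Zm p)) := by
    refine (gaussKK N).1.mono' (FF_meas _ _ Zm_meas).aestronglyMeasurable (Eventually.of_forall fun p => ?_)
    rw [Real.norm_eq_abs, abs_of_nonneg (FF_nonneg _ _)]
    exact FF_le _ (by positivity) _
  rw [Measure.volume_eq_prod, integral_prod _ hi, ← integral_const_mul]
  congr 1; ext τ
  have := Measure.integral_comp_smul (volume : Measure (Fin N × Fin N → ℝ)) (fun x => FF (s^2) (Zm (τ, x))) s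
  rw [abs_of_pos (by positivity)] at this
  simp only [Module.finrank_fintype_fun_eq_card, Fintype.card_prod, Fintype.card_fin, smul_eq_mul] at this
  exact this

lemma CC_eq (N : ℕ) : CC N = ∏ p : Fin N × Fin N, √(π / cq p) := by
  have : (fun x : KK N => Real.exp (-∑ p, cq p * x p ^2)) = fun x => ∏ p, Real.exp (-cq p * (x p)^2) := by
    ext x; rw [← Real.exp_sum, ← Finset.sum_neg_distrib]; simp
  rw [CC, this]
  refine (integral_fintype_prod_volume_eq_prod (fun (p : Fin N × Fin N) (y : ℝ) => Real.exp (-cq p * y^2))).trans ?_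
  simp_rw [integral_gaussian]

lemma half_int (m : ℕ) : ∫ y : ℝ, (if 0 < y then y^(2*m+1) * Real.exp (-y^2) else 0) = m.factorial / 2 := by
  have h := integral_rpow_mul_exp_neg_rpow (p := 2) (q := 2*m+1) (by norm_num) (by linarith [Nat.cast_nonneg (α := ℝ) m])
  have h1 : (fun y : ℝ => if 0 < y then y^(2*m+1) * Real.exp (-y^2) else 0)
      = Set.indicator (Set.Ioi 0) (fun y : ℝ => y ^ ((2*m+1 : ℝ)) * Real.exp (-y ^ (2:ℝ))) := by
    ext y
    simp only [Set.indicator, Set.mem_Ioi]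
    split_ifs with hy
    · have e1 : y ^ (2*m+1) = y ^ ((2*m+1 : ℝ)) := by rw [← Real.rpow_natCast]; push_cast; rfl
      rw [e1, Real.rpow_two]
    · rfl
  rw [h1, integral_indicator measurableSet_Ioi, h]
  have : ((2*m+1 : ℝ) + 1)/2 = m + 1 := by ring
  rw [this, Real.Gamma_nat_eq_factorial]; ring

noncomputable def hdp {N : ℕ} (p : Fin N × Fin N) (y : ℝ) : ℝ :=
  if p.1 = p.2 then (if 0 < y then y^(2*(N-1-p.1)+1) * Real.exp (-y^2) else 0) else Real.exp (-y^2)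

lemma prod_diag {N : ℕ} (f : Fin N → ℝ) (c : ℝ) :
    ∏ p : Fin N × Fin N, (if p.1 = p.2 then f p.1 else c) = (∏ i, f i) * c^(N*(N-1)) := by
  rw [Fintype.prod_prod_type]
  have : ∀ i : Fin N, ∏ j, (if i = j then f i else c) = f i * c^(N-1) := by
    intro i
    rw [← Finset.mul_prod_erase _ _ (Finset.mem_univ i), if_pos rfl]
    congr 1
    rw [Finset.prod_congr rfl (g := fun _ => c)]
    · simp
    · intro j hj
      rw [if_neg (Finset.ne_of_mem_erase hj).symm]
  simp only [this, Finset.prod_mul_distrib, Finset.prod_const, ← pow_mul]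
  simp [mul_comm]

lemma HH_eq {N : ℕ} (τ : KK N) : HH τ = CC N * ∏ p, hdp p (τ p) := by
  have h1 : ∀ p : Fin N × Fin N, hdp p (τ p) = Real.exp (-τ p ^2) *
      (if p.1 = p.2 then (if 0 < τ (p.1,p.1) then τ (p.1,p.1)^(2*(N-1-p.1)+1) else 0) else 1) := by
    rintro ⟨i, j⟩
    by_cases h : i = j
    · subst h; simp only [hdp, if_true]; split_ifs <;> ring
    · simp [hdp, h]
  simp only [h1]
  rw [Finset.prod_mul_distrib, prod_diag (fun i => if 0 < τ (i,i) then τ (i,i)^(2*(N-1-i)+1) else 0) 1, one_pow, mul_one,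
    ← Real.exp_sum, Finset.sum_neg_distrib, HH]
  split_ifs with h
  · rw [Finset.prod_congr rfl fun i _ => if_pos (h i)]; ring
  · push Not at h
    obtain ⟨k, hk⟩ := h
    rw [Finset.prod_eq_zero (Finset.mem_univ k) (if_neg hk.not_gt)]; simp

lemma HH_int (N : ℕ) : ∫ τ : KK N, HH τ = CC N * ((∏ i : Fin N, ((N-1-i).factorial / 2 : ℝ)) * √π^(N*(N-1))) := by
  simp_rw [HH_eq]
  rw [integral_const_mul]
  congr 1
  refine (integral_fintype_prod_volume_eq_prod (fun (p : Fin N × Fin N) (y : ℝ) => hdp p y)).trans ?_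
  rw [← prod_diag]
  refine Finset.prod_congr rfl fun p _ => ?_
  simp only [hdp]
  split_ifs
  · exact half_int _
  · exact gauss1

lemma const_id (N : ℕ) : (π^(N*N))⁻¹ * ∫ τ : KK N, HH τ = (1 : ℝ) / ((2 * π) ^ N * (Nat.factorial N)) *
    (N.factorial * ∏ k : Fin N, ((1/2:ℝ)^(k:ℕ) * (k:ℕ).factorial * √π)) := by
  have hC : CC N = √π^N * √(π/2)^(N*(N-1)) := by
    rw [CC_eq, ← Finset.card_fin N, ← Finset.prod_const, Finset.card_fin, ← prod_diag]
    refine Finset.prod_congr rfl fun p _ => ?_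
    simp only [cq]; split_ifs <;> simp
  have hrev : ∏ i : Fin N, ((N-1-i).factorial : ℝ) = ∏ i : Fin N, ((i:ℕ).factorial : ℝ) := by
    rw [← Equiv.prod_comp Fin.revPerm (fun i : Fin N => ((i:ℕ).factorial : ℝ))]
    refine Finset.prod_congr rfl fun i _ => ?_
    simp only [Fin.revPerm_apply, Fin.val_rev]
    congr 2; omega
  have hpow : ∏ k : Fin N, (1/2:ℝ)^(k:ℕ) = (√2)⁻¹ ^(N*(N-1)) := by
    have h2 : (1/2:ℝ) = (√2)⁻¹^2 := by rw [inv_pow, Real.sq_sqrt (by norm_num)]; norm_num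
    rw [h2]
    simp only [← pow_mul]
    rw [Finset.prod_pow_eq_pow_sum, ← Finset.sum_range_id_mul_two, ← Finset.mul_sum,
      Fin.sum_univ_eq_sum_range (fun i => i) N, mul_comm]
  have hπ : √π ≠ 0 := (Real.sqrt_pos.2 Real.pi_pos).ne'
  have hN2 : N * N = N*(N-1) + N := by
    cases N with
    | zero => rfl
    | succ n => simp; ring
  have hf : (N.factorial : ℝ) ≠ 0 := by positivity
  rw [HH_int, hC, Finset.prod_div_distrib, hrev, Finset.prod_mul_distrib, Finset.prod_mul_distrib, hpow,
    Finset.prod_const, Finset.prod_const, Finset.card_univ, Fintype.card_fin, Real.sqrt_div Real.pi_pos.le, div_pow, hN2, pow_add]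
  have hsq : π = √π^2 := (Real.sq_sqrt Real.pi_pos.le).symm
  have e1 : π^(N*(N-1)) = √π^(N*(N-1)) * √π^(N*(N-1)) := by
    rw [← mul_pow, Real.mul_self_sqrt Real.pi_pos.le]
  have e2 : π^N = √π^N * √π^N := by
    rw [← mul_pow, Real.mul_self_sqrt Real.pi_pos.le]
  rw [mul_pow, e1, e2, inv_pow]
  have := pow_ne_zero (N*(N-1)) hπ
  have := pow_ne_zero N hπ
  generalize √π^(N*(N-1)) = A at *
  generalize √π^N = B at *
  field_simp

/-- the paper's Corollary 2, `d = 2` continuum limit: for `μ` the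
normalized Haar (probability) measure on `U(N)`,
`lim_{β→0⁺} β^{−N²/2} ∫_{U(N)} exp(−‖1 − U‖²_F/β) dμ(U)
  = (1/((2π)^N N!)) ∫_{ℝ^N} e^{−|y|²} ∏_{j<k} (y_j − y_k)² dy`. -/
theorem cue_single_bond_continuum_limit (N : ℕ) (hN : 1 ≤ N)
    (μ : Measure (Matrix.unitaryGroup (Fin N) ℂ))
    [IsProbabilityMeasure μ] [μ.IsMulLeftInvariant] :
    Tendsto
      (fun β : ℝ => β ^ (-(N ^ 2 : ℝ) / 2) *
        ∫ U : Matrix.unitaryGroup (Fin N) ℂ,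
          Real.exp (-frobSq (1 - (U : Matrix (Fin N) (Fin N) ℂ)) / β) ∂μ)
      (nhdsWithin 0 (Set.Ioi 0))
      (nhds ((1 : ℝ) / ((2 * π) ^ N * (Nat.factorial N)) *
        ∫ y : Fin N → ℝ, Real.exp (-(∑ i, y i ^ 2)) *
          ∏ p ∈ Finset.univ.filter (fun p : Fin N × Fin N => p.1 < p.2),
            (y p.1 - y p.2) ^ 2)) := by
  rw [mehta, ← const_id]
  have hs : Tendsto (fun β : ℝ => √β) (nhdsWithin 0 (Set.Ioi 0)) (nhdsWithin 0 (Set.Ioi 0)) := by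
    refine tendsto_nhdsWithin_iff.2 ⟨?_, ?_⟩
    · have := (Real.continuous_sqrt.tendsto 0).mono_left (nhdsWithin_le_nhds (s := Set.Ioi 0))
      simpa using this
    · filter_upwards [self_mem_nhdsWithin] with β hβ
      exact Real.sqrt_pos.2 hβ
  refine (((outer_lim hN).comp hs).const_mul _).congr' ?_
  filter_upwards [self_mem_nhdsWithin] with β hβ
  have hβ : 0 < β := hβ
  simp only [Function.comp]
  rw [J_scale _ (Real.sqrt_pos.2 hβ), Real.sq_sqrt hβ.le, haar_gauss N μ β hβ]
  have h1 : β ^ (-(N ^ 2 : ℝ) / 2) = (√β^(N*N))⁻¹ := by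
    rw [Real.sqrt_eq_rpow, ← Real.rpow_natCast _ (N*N), ← Real.rpow_mul hβ.le, ← Real.rpow_neg hβ.le]
    congr 1; push_cast; ring
  rw [h1]
  have : π^(N*N) ≠ 0 := by positivity
  field_simp
end
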